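/- arXiv:1704.08365 — 14 statements merged into one kernel-verified Lean document; each statement's English description precedes it below -/
import Mathlib

section
/- Let R be a nontrivial commutative indecomposable ring and P a set. A map φ : Π → Π is an R-algebra automorphism of Π = ∏_{x∈P} R if and only if there exists a permutation ρ of P such that φ = ρ̂, i.e., (φ a)_{ρ(x)} = a_x for all a ∈ Π and all x ∈ P. -/
theorem aux_point {R : Type*} [CommRing R] [Nontrivial R]
    (hR : ∀ r : R, IsIdempotentElem r → r = 0 ∨ r = 1)
    {P : Type*} (ψ : (P → R) ≃ₐ[R] (P → R)) (x : P) :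
    ∃ y, ∀ a : P → R, ψ a y = a x := by
  classical
  have hne : ψ (Pi.single x 1) ≠ 0 := by
    intro h
    have h0 : (Pi.single x 1 : P → R) = 0 := by simpa using h
    have := congrFun h0 x
    simp at this
  obtain ⟨y, hy⟩ := Function.ne_iff.mp hne
  have hid : IsIdempotentElem (ψ (Pi.single x 1) y) := by
    have h : (Pi.single x 1 : P → R) * Pi.single x 1 = Pi.single x 1 := by
      rw [← Pi.single_mul]; simp
    have h2 := congrFun (congrArg ψ h) y
    rw [map_mul] at h2
    exact h2
  have h1 : ψ (Pi.single x 1) y = 1 := (hR _ hid).resolve_left hy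
  refine ⟨y, fun a => ?_⟩
  have h : a * (Pi.single x 1 : P → R) = a x • (Pi.single x 1 : P → R) := by
    funext z
    by_cases hz : z = x
    · subst hz; simp
    · simp [hz]
  have h2 := congrFun (congrArg ψ h) y
  rw [map_mul, map_smul] at h2
  simpa [h1] using h2

theorem aux_sep {R : Type*} [CommRing R] [Nontrivial R] {P : Type*} {u v : P}
    (h : ∀ b : P → R, b u = b v) : u = v := by
  classical
  by_contra hne
  have := h (Pi.single u 1)
  simp [Ne.symm hne] at this

/-- For a nontrivial commutative indecomposable ring `R` and a set `P`,
a map `φ : Π → Π` on `Π = ∏_{x ∈ P} R` is an `R`-algebra automorphism iff there is a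
permutation `ρ` of `P` with `(φ a) (ρ x) = a x` for all `a` and `x`. -/
theorem stmt0 {R : Type*} [CommRing R] [Nontrivial R]
    (hR : ∀ r : R, IsIdempotentElem r → r = 0 ∨ r = 1)
    {P : Type*} (φ : (P → R) → (P → R)) :
    (∃ ψ : (P → R) ≃ₐ[R] (P → R), ⇑ψ = φ) ↔
      ∃ ρ : Equiv.Perm P, ∀ (a : P → R) (x : P), φ a (ρ x) = a x := by
  constructor
  · rintro ⟨ψ, rfl⟩
    choose σ hσ using aux_point hR ψ
    choose τ hτ using aux_point hR ψ.symm
    refine ⟨⟨σ, τ, fun x => ?_, fun y => ?_⟩, fun a x => hσ x a⟩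
    · refine aux_sep (R := R) fun b => ?_
      have h := hτ (σ x) (ψ b)
      rw [hσ] at h
      simpa using h
    · refine aux_sep (R := R) fun b => ?_
      have h := hσ (τ y) (ψ.symm b)
      rw [hτ] at h
      simpa using h
  · rintro ⟨ρ, hρ⟩
    have hφ : ∀ a y, φ a y = a (ρ.symm y) := fun a y => by
      simpa using hρ a (ρ.symm y)
    refine ⟨{ toFun := φ
              invFun := fun a x => a (ρ x)
              left_inv := fun a => by funext x; simp [hφ]
              right_inv := fun a => by funext x; simp [hφ]
              map_mul' := fun a b => by funext x; simp [hφ]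
              map_add' := fun a b => by funext x; simp [hφ]
              commutes' := fun r => by funext x; simp [hφ] }, rfl⟩
end

section
/- Let R be a nontrivial commutative indecomposable ring with at least 3 elements, P a set, and η a local automorphism of Π = ∏_{x∈P} R such that e_x lies in the image of η for every x ∈ P. Then η is an R-algebra automorphism of Π; more precisely, η = ρ̂ for some permutation ρ of P. -/
theorem aux_auto {R : Type*} [CommRing R] [Nontrivial R]
    (hR : ∀ r : R, IsIdempotentElem r → r = 0 ∨ r = 1) {P : Type*}
    (φ : (P → R) ≃ₐ[R] (P → R)) (y : P) :
    ∃ x : P, φ (Set.indicator {x} 1) = Set.indicator {y} 1 ∧ ∀ a, φ a y = a x := by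
  classical
  have ey : φ (φ.symm (Set.indicator {y} 1)) = Set.indicator {y} (1 : P → R) := by simp
  generalize φ.symm (Set.indicator {y} 1) = a at ey
  have idem : a * a = a := by
    apply φ.injective
    rw [map_mul, ey]
    ext z
    by_cases h : z = y <;> simp [h]
  have hne : ∃ x, a x = 1 := by
    by_contra hcon
    push Not at hcon
    have h0 : a = 0 := by
      ext x
      rcases hR (a x) (congrFun idem x) with h | h
      · exact h
      · exact absurd h (hcon x)
    rw [h0, map_zero] at ey
    have := congrFun ey y
    simp at this
  obtain ⟨x, hx⟩ := hne
  have h1 : Set.indicator {x} (1 : P → R) * a = Set.indicator {x} 1 := by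
    ext z
    by_cases h : z = x
    · subst h; simp [hx]
    · simp [h]
  have h2 : φ (Set.indicator {x} 1) * Set.indicator {y} 1 = φ (Set.indicator {x} 1) := by
    rw [← ey, ← map_mul, h1]
  have h3 : φ (Set.indicator {x} 1) * φ (Set.indicator {x} 1) = φ (Set.indicator {x} 1) := by
    rw [← map_mul]
    congr 1
    ext z
    by_cases h : z = x <;> simp [h]
  have h4 : φ (Set.indicator {x} 1) = Set.indicator {y} 1 := by
    have hz : ∀ z, z ≠ y → φ (Set.indicator {x} 1) z = 0 := by
      intro z hz
      rw [← h2]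
      simp [hz]
    rcases hR _ (congrFun h3 y) with h | h
    · exfalso
      have h0 : φ (Set.indicator {x} 1) = 0 := by
        ext z
        by_cases hzy : z = y
        · rw [hzy, h]; rfl
        · rw [hz z hzy]; rfl
      have := congrFun ((map_eq_zero_iff φ φ.injective).1 h0) x
      simp at this
    · ext z
      by_cases hzy : z = y
      · subst hzy; rw [h]; simp
      · rw [hz z hzy]; simp [hzy]
  refine ⟨x, h4, fun b => ?_⟩
  have h5 : b * Set.indicator {x} 1 = b x • Set.indicator {x} (1 : P → R) := by
    ext z
    by_cases h : z = x
    · subst h; simp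
    · simp [h]
  have h6 := congrArg φ h5
  rw [map_mul, map_smul, h4] at h6
  simpa using congrFun h6 y

/-- If `R` is a nontrivial commutative indecomposable ring with at least 3
elements and `η` is a local automorphism of `Π = ∏_{x ∈ P} R` whose image contains every
`e_x`, then `η` is an `R`-algebra automorphism; more precisely `η = ρ̂` for some
permutation `ρ` of `P`. -/
theorem stmt2 {R : Type*} [CommRing R] [Nontrivial R]
    (hR : ∀ r : R, IsIdempotentElem r → r = 0 ∨ r = 1)
    (hcard : 3 ≤ Cardinal.mk R)
    {P : Type*} (η : (P → R) →ₗ[R] (P → R))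
    (hloc : ∀ a : P → R, ∃ φ : (P → R) ≃ₐ[R] (P → R), η a = φ a)
    (himg : ∀ x : P, (Set.indicator {x} 1 : P → R) ∈ Set.range η) :
    (∃ ψ : (P → R) ≃ₐ[R] (P → R), ⇑ψ = ⇑η) ∧
      ∃ ρ : Equiv.Perm P, ∀ (a : P → R) (x : P), η a (ρ x) = a x := by
  classical
  have hrange : ∀ a y, ∃ x, η a y = a x := by
    intro a y
    obtain ⟨φ, hφ⟩ := hloc a
    obtain ⟨x, -, hx⟩ := aux_auto hR φ y
    exact ⟨x, by rw [hφ, hx]⟩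
  have hinj : Function.Injective η := by
    rw [injective_iff_map_eq_zero]
    intro a ha
    obtain ⟨φ, hφ⟩ := hloc a
    rw [hφ] at ha
    exact (map_eq_zero_iff φ φ.injective).1 ha
  have eInj : ∀ x y : P, (Set.indicator {x} 1 : P → R) = Set.indicator {y} 1 → x = y := by
    intro x y h
    by_contra hne
    have := congrFun h x
    simp [hne] at this
  have hτ : ∀ y, ∃ x, η (Set.indicator {x} 1) = Set.indicator {y} 1 := by
    intro y
    obtain ⟨a, ha⟩ := himg y
    obtain ⟨φ, hφ⟩ := hloc a
    obtain ⟨x, hx, -⟩ := aux_auto hR φ y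
    refine ⟨x, ?_⟩
    have : a = Set.indicator {x} 1 := φ.injective (by rw [← hφ, ha, hx])
    rw [← this, ha]
  choose τ hτ using hτ
  have τinj : Function.Injective τ := by
    intro y z h
    apply eInj
    rw [← hτ y, ← hτ z, h]
  have τsurj : Function.Surjective τ := by
    intro x
    obtain ⟨φ, hφ⟩ := hloc (Set.indicator {x} 1)
    obtain ⟨z, hz, -⟩ := aux_auto hR φ.symm x
    refine ⟨z, eInj _ _ (hinj ?_)⟩
    rw [hτ, hφ, ← hz]
    simp
  obtain ⟨s, hs0, hs1⟩ : ∃ s : R, s ≠ 0 ∧ s ≠ -1 := by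
    by_contra hcon
    push Not at hcon
    have hu : (Set.univ : Set R) ⊆ {0, -1} := by
      intro s _
      by_cases h : s = 0
      · simp [h]
      · simp [hcon s h]
    have h1 : Cardinal.mk R ≤ 2 := by
      rw [← Cardinal.mk_univ]
      refine (Cardinal.mk_le_mk_of_subset hu).trans ?_
      refine Cardinal.mk_insert_le.trans ?_
      rw [Cardinal.mk_singleton, one_add_one_eq_two]
    have h2 := hcard.trans h1
    norm_num at h2
  have key1 : ∀ (S : Set P) (y : P), τ y ∉ S → η (Set.indicator S 1) y = 0 := by
    intro S y hy
    obtain ⟨x, hx⟩ := hrange (Set.indicator S 1) y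
    by_cases hxS : x ∈ S
    · exfalso
      have h1 : η (Set.indicator S 1) y = 1 := by rw [hx]; simp [hxS]
      obtain ⟨z, hz⟩ := hrange (Set.indicator S 1 + s • Set.indicator {τ y} 1) y
      rw [map_add, map_smul, hτ] at hz
      simp only [Pi.add_apply, Pi.smul_apply, h1] at hz
      by_cases hzt : z = τ y
      · subst hzt
        simp [hy] at hz
      · by_cases hzS : z ∈ S
        · simp [hzt, hzS, hs0] at hz
        · simp [hzt, hzS] at hz
          exact hs1 (eq_neg_of_add_eq_zero_right hz)
    · rw [hx]; simp [hxS]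
  have key2 : ∀ a y, η a y = a (τ y) := by
    intro a y
    by_contra hne
    have hS : τ y ∉ {z | a z = η a y} := fun h => hne h.symm
    obtain ⟨z, hz⟩ := hrange (a + Set.indicator {z | a z = η a y} 1) y
    rw [map_add, Pi.add_apply, key1 _ y hS, add_zero, Pi.add_apply] at hz
    by_cases h : a z = η a y
    · rw [Set.indicator_of_mem (by exact h), h] at hz
      simp at hz
    · rw [Set.indicator_of_notMem (by exact h), add_zero] at hz
      exact h hz.symm
  let T : Equiv.Perm P := Equiv.ofBijective τ ⟨τinj, τsurj⟩
  refine ⟨⟨AlgEquiv.piCongrLeft' R (fun _ => R) T.symm, ?_⟩, T.symm, fun a x => ?_⟩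
  · funext a
    ext y
    rw [key2]
    rfl
  · rw [key2]
    exact congrArg a (T.apply_symm_apply x)
end

section
/- Let R be a nontrivial commutative indecomposable ring with at least 3 elements, P a set, and η a surjective local automorphism of Π = ∏_{x∈P} R. Then η is an R-algebra automorphism of Π. -/
theorem aut_single {R : Type*} [CommRing R] [Nontrivial R]
    (hR : ∀ r : R, IsIdempotentElem r → r = 0 ∨ r = 1) {P : Type*} [DecidableEq P]
    (φ : (P → R) ≃ₐ[R] (P → R)) (y : P) :
    ∃ x : P, φ (Pi.single x 1) = Pi.single y 1 := by
  obtain ⟨a, ha⟩ := φ.surjective (Pi.single y 1)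
  have hane : a ≠ 0 := by
    rintro rfl
    have := congrFun ha y
    simp at this
  have haid : a * a = a := by
    apply φ.injective
    rw [map_mul, ha, ← Pi.single_mul, one_mul]
  obtain ⟨x, hx⟩ := Function.ne_iff.mp hane
  have hx1 : a x = 1 := by
    rcases hR (a x) (congrFun haid x) with h | h
    · exact absurd h hx
    · exact h
  refine ⟨x, ?_⟩
  have h1 : (Pi.single x 1 : P → R) * a = Pi.single x 1 := by
    funext z
    by_cases hz : z = x
    · subst hz; simp [hx1]
    · simp [hz]
  have h2 : φ (Pi.single x 1) * Pi.single y 1 = φ (Pi.single x 1) := by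
    rw [← ha, ← map_mul, h1]
  have h3 : φ (Pi.single x 1) * φ (Pi.single x 1) = φ (Pi.single x 1) := by
    rw [← map_mul, ← Pi.single_mul, one_mul]
  have h4 : ∀ z, z ≠ y → φ (Pi.single x 1) z = 0 := by
    intro z hz
    have := congrFun h2 z
    simpa [hz] using this.symm
  have h5 : φ (Pi.single x 1) y = 1 := by
    rcases hR _ (congrFun h3 y) with h | h
    · exfalso
      have h0 : φ (Pi.single x 1) = 0 := by
        funext z
        by_cases hz : z = y
        · subst hz; exact h
        · exact h4 z hz
      have h6 : (Pi.single x 1 : P → R) = 0 := φ.injective (by rw [h0, map_zero])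
      have := congrFun h6 x
      simp at this
    · exact h
  funext z
  by_cases hz : z = y
  · subst hz; simp [h5]
  · simp [hz, h4 z hz]

theorem aut_apply {R : Type*} [CommRing R]
    {P : Type*} [DecidableEq P]
    (φ : (P → R) ≃ₐ[R] (P → R)) (x y : P) (h : φ (Pi.single x 1) = Pi.single y 1)
    (a : P → R) : φ a y = a x := by
  have h1 : a * Pi.single x 1 = a x • (Pi.single x 1 : P → R) := by
    funext z
    by_cases hz : z = x
    · subst hz; simp
    · simp [hz]
  have h2 := congrArg φ h1
  rw [map_mul, map_smul, h] at h2
  simpa using congrFun h2 y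

/-- If `R` is a nontrivial commutative indecomposable ring with at least 3
elements, then every surjective local automorphism of `Π = ∏_{x ∈ P} R` is an `R`-algebra
automorphism. -/
theorem stmt3 {R : Type*} [CommRing R] [Nontrivial R]
    (hR : ∀ r : R, IsIdempotentElem r → r = 0 ∨ r = 1)
    (hcard : 3 ≤ Cardinal.mk R)
    {P : Type*} (η : (P → R) →ₗ[R] (P → R))
    (hloc : ∀ a : P → R, ∃ φ : (P → R) ≃ₐ[R] (P → R), η a = φ a)
    (hsurj : Function.Surjective η) :
    ∃ ψ : (P → R) ≃ₐ[R] (P → R), ⇑ψ = ⇑η := by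
  classical
  have hval : ∀ (a : P → R) (y : P), ∃ x, η a y = a x := by
    intro a y
    obtain ⟨φ, hφ⟩ := hloc a
    obtain ⟨x, hx⟩ := aut_single hR φ y
    exact ⟨x, by rw [hφ, aut_apply φ x y hx]⟩
  have hsing : ∀ y : P, ∃ x : P, η (Pi.single x 1) = Pi.single y 1 := by
    intro y
    obtain ⟨a, ha⟩ := hsurj (Pi.single y 1)
    obtain ⟨φ, hφ⟩ := hloc a
    obtain ⟨x, hx⟩ := aut_single hR φ y
    have : a = Pi.single x 1 := φ.injective (by rw [← hφ, ha, hx])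
    exact ⟨x, by rw [← this, ha]⟩
  obtain ⟨r, hr0, hr1⟩ : ∃ r : R, r ≠ 0 ∧ r ≠ 1 := by
    by_contra! hcon
    have hsub : (Set.univ : Set R) ⊆ {0, 1} := by
      intro s _
      by_cases h : s = 0
      · simp [h]
      · simp [hcon s h]
    have h1 := Cardinal.mk_le_mk_of_subset hsub
    rw [Cardinal.mk_univ] at h1
    have h2 : Cardinal.mk ({0, 1} : Set R) ≤ 2 := by
      refine Cardinal.mk_insert_le.trans ?_
      rw [Cardinal.mk_singleton, one_add_one_eq_two]
    have h3 := hcard.trans (h1.trans h2)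
    norm_cast at h3
  choose g hg using hsing
  -- indicators of sets avoiding `g y` vanish at `y`
  have hind : ∀ (B : Set P) (y : P), g y ∉ B → η (B.indicator 1) y = 0 := by
    intro B y hy
    have hs : ∀ s : R, η (B.indicator 1) y + s = 0 ∨ η (B.indicator 1) y + s = 1 ∨
        η (B.indicator 1) y + s = s := by
      intro s
      obtain ⟨x, hx⟩ := hval (B.indicator 1 + s • Pi.single (g y) 1) y
      rw [map_add, map_smul, hg] at hx
      simp only [Pi.add_apply, Pi.smul_apply, Pi.single_eq_same, smul_eq_mul, mul_one] at hx
      rw [hx]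
      by_cases hxy : x = g y
      · subst hxy; simp [hy]
      · by_cases hxB : x ∈ B <;> simp [hxy, hxB]
    have h0 := hs 0
    have h1 := hs 1
    have h2 := hs r
    by_contra hne
    have he : η (B.indicator 1) y = 1 := by simpa [hne] using h0
    rw [he] at h1 h2
    have h1' : (1 : R) + 1 = 0 := by
      rcases h1 with h | h | h
      · exact h
      · exact absurd (by linear_combination h) (one_ne_zero (α := R))
      · exact absurd (by linear_combination h) (one_ne_zero (α := R))
    rcases h2 with h | h | h
    · exact hr1 (by linear_combination h - h1')
    · exact hr0 (by linear_combination h)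
    · exact absurd (by linear_combination h) (one_ne_zero (α := R))
  have hzero : ∀ (b : P → R) (y : P), b (g y) = 0 → η b y = 0 := by
    intro b y hb
    by_contra hc
    set c := η b y with hcdef
    let B : Set P := {z | b z = c}
    have hyB : g y ∉ B := fun h => hc (by rw [← (show b (g y) = c from h), hb])
    obtain ⟨x, hx⟩ := hval (b - c • B.indicator 1) y
    rw [map_sub, map_smul] at hx
    simp only [Pi.sub_apply, Pi.smul_apply, hind B y hyB, smul_zero, sub_zero] at hx
    rw [← hcdef] at hx
    by_cases hxB : x ∈ B
    · have : b x = c := hxB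
      simp [hxB, this] at hx
      exact hc hx
    · simp [hxB] at hx
      exact hxB hx.symm
  have hmain : ∀ (a : P → R) (y : P), η a y = a (g y) := by
    intro a y
    have h := hzero (a - a (g y) • Pi.single (g y) 1) y (by simp)
    rw [map_sub, map_smul, hg] at h
    simpa [sub_eq_zero] using h
  have hinj : Function.Injective η := by
    rw [injective_iff_map_eq_zero]
    intro a ha
    obtain ⟨φ, hφ⟩ := hloc a
    exact φ.injective (by rw [← hφ, ha, map_zero])
  refine ⟨AlgEquiv.ofBijective (AlgHom.ofLinearMap η ?_ ?_) ⟨hinj, hsurj⟩, rfl⟩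
  · funext y; simp [hmain]
  · intro a b; funext y; simp [hmain]
end

section
/- Let R be a nontrivial commutative indecomposable ring, P a set, and η a 2-local automorphism of Π = ∏_{x∈P} R such that e_x lies in the image of η for every x ∈ P. Then η is an R-algebra automorphism of Π; more precisely, η = ρ̂ for some permutation ρ of P. -/
theorem aux_mul {R : Type*} [CommRing R] {P : Type*} (a : P → R) (x : P) :
    a * (Set.indicator {x} 1 : P → R) = a x • (Set.indicator {x} 1 : P → R) := by
  classical
  funext z
  by_cases h : z = x
  · subst h; simp
  · simp [h]

theorem aux_ne {R : Type*} [CommRing R] [Nontrivial R] {P : Type*} (x : P) :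
    (Set.indicator {x} 1 : P → R) ≠ 0 := by
  intro h
  have := congrFun h x
  simp at this

theorem aux_inj {R : Type*} [CommRing R] [Nontrivial R] {P : Type*} {x y : P}
    (h : (Set.indicator {x} 1 : P → R) = Set.indicator {y} 1) : x = y := by
  by_contra hne
  have := congrFun h x
  simp [hne] at this

theorem aux_prim {R : Type*} [CommRing R] [Nontrivial R]
    (hR : ∀ r : R, IsIdempotentElem r → r = 0 ∨ r = 1)
    {P : Type*} (φ : (P → R) ≃ₐ[R] (P → R)) (x : P) :
    ∃ y, φ (Set.indicator {x} 1) = Set.indicator {y} 1 := by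
  have hid : ∀ z : P, IsIdempotentElem (Set.indicator {z} 1 : P → R) := by
    intro z
    have := aux_mul (Set.indicator {z} 1 : P → R) z
    simpa [IsIdempotentElem] using this
  have hne : φ (Set.indicator {x} 1) ≠ 0 := by
    intro h
    exact aux_ne (R := R) x ((map_eq_zero_iff φ φ.injective).1 h)
  obtain ⟨y, hy⟩ := Function.ne_iff.1 hne
  have h1 : φ (Set.indicator {x} 1) y = 1 :=
    (hR _ (congrFun ((hid x).map φ) y)).resolve_left hy
  have h2 := aux_mul (φ (Set.indicator {x} 1)) y
  rw [h1, one_smul] at h2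
  have h3 := congrArg φ (aux_mul (φ.symm (Set.indicator {y} 1)) x)
  rw [map_mul, AlgEquiv.apply_symm_apply, map_smul, mul_comm, h2] at h3
  refine ⟨y, ?_⟩
  rcases hR _ (congrFun ((hid y).map φ.symm) x) with h | h
  · rw [h, zero_smul] at h3
    exact absurd h3 (aux_ne y)
  · rw [h, one_smul] at h3
    exact h3.symm

theorem aux_val {R : Type*} [CommRing R] {P : Type*} (φ : (P → R) ≃ₐ[R] (P → R)) {x y : P}
    (h : φ (Set.indicator {x} 1) = Set.indicator {y} 1) (a : P → R) : φ a y = a x := by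
  have h3 := congrArg φ (aux_mul a x)
  rw [map_mul, map_smul, h] at h3
  simpa using congrFun h3 y

/-- If `R` is a nontrivial commutative indecomposable ring and `η` is a
2-local automorphism of `Π = ∏_{x ∈ P} R` whose image contains every `e_x`, then `η` is an
`R`-algebra automorphism; more precisely `η = ρ̂` for some permutation `ρ` of `P`. -/
theorem stmt4 {R : Type*} [CommRing R] [Nontrivial R]
    (hR : ∀ r : R, IsIdempotentElem r → r = 0 ∨ r = 1)
    {P : Type*} (η : (P → R) →ₗ[R] (P → R))
    (hloc : ∀ a b : P → R, ∃ φ : (P → R) ≃ₐ[R] (P → R), η a = φ a ∧ η b = φ b)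
    (himg : ∀ x : P, (Set.indicator {x} 1 : P → R) ∈ Set.range η) :
    (∃ ψ : (P → R) ≃ₐ[R] (P → R), ⇑ψ = ⇑η) ∧
      ∃ ρ : Equiv.Perm P, ∀ (a : P → R) (x : P), η a (ρ x) = a x := by
  have hf : ∀ x, ∃ y, η (Set.indicator {x} 1) = Set.indicator {y} 1 := by
    intro x
    obtain ⟨φ, h, -⟩ := hloc (Set.indicator {x} 1) 0
    obtain ⟨y, hy⟩ := aux_prim hR φ x
    exact ⟨y, h.trans hy⟩
  choose f hf using hf
  have hbij : Function.Bijective f := by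
    constructor
    · intro x x' hxx
      obtain ⟨φ, h, h'⟩ := hloc (Set.indicator {x} 1) (Set.indicator {x'} 1)
      rw [hf] at h h'
      rw [hxx, h'] at h
      exact (aux_inj (φ.injective h)).symm
    · intro y
      obtain ⟨a, ha⟩ := himg y
      obtain ⟨φ, h, -⟩ := hloc a 0
      obtain ⟨x, hx⟩ := aux_prim hR φ.symm y
      rw [← ha, h, AlgEquiv.symm_apply_apply] at hx
      refine ⟨x, aux_inj (R := R) ?_⟩
      rw [← hf, ← hx, ha]
  have key : ∀ (a : P → R) (x : P), η a (f x) = a x := by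
    intro a x
    obtain ⟨φ, h, h'⟩ := hloc a (Set.indicator {x} 1)
    rw [h]
    exact aux_val φ (h'.symm.trans (hf x)) a
  let ρ : Equiv.Perm P := Equiv.ofBijective f hbij
  refine ⟨⟨AlgEquiv.piCongrLeft R (fun _ => R) ρ, ?_⟩, ρ, key⟩
  funext a y
  obtain ⟨x, rfl⟩ := ρ.surjective y
  refine Eq.trans ?_ (key a x).symm
  exact Equiv.piCongrLeft_apply_apply (fun _ => R) ρ a x
end

section
/- Let R be a nontrivial commutative indecomposable ring, P a set, and η a surjective 2-local automorphism of Π = ∏_{x∈P} R. Then η is an R-algebra automorphism of Π. -/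
open Classical in
/-- An algebra automorphism maps some singleton indicator to the singleton indicator at `y`. -/
theorem exists_single_preimage {R : Type*} [CommRing R] [Nontrivial R]
    (hR : ∀ r : R, IsIdempotentElem r → r = 0 ∨ r = 1)
    {P : Type*} (φ : (P → R) ≃ₐ[R] (P → R)) (y : P) :
    ∃ x, φ (Pi.single x 1) = Pi.single y 1 := by
  obtain ⟨f, hf⟩ := φ.surjective (Pi.single y 1)
  have hidem : f * f = f := by
    apply φ.injective
    rw [map_mul, hf]
    ext z
    by_cases h : z = y
    · subst h; simp
    · simp [h]
  have hne : ∃ x, f x ≠ 0 := by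
    by_contra! h
    have h0 : f = 0 := funext h
    rw [h0, map_zero] at hf
    have := congrFun hf y
    simp at this
  obtain ⟨x, hx⟩ := hne
  have hx1 : f x = 1 := (hR (f x) (congrFun hidem x)).resolve_left hx
  have hfe : f * Pi.single x 1 = (Pi.single x 1 : P → R) := by
    ext z
    by_cases h : z = x
    · subst h; simp [hx1]
    · simp [h]
  have hφ : Pi.single y 1 * φ (Pi.single x 1) = φ (Pi.single x 1) := by
    rw [← hf, ← map_mul, hfe]
  have hee : (Pi.single x 1 : P → R) * Pi.single x 1 = Pi.single x 1 := by
    ext z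
    by_cases h : z = x
    · subst h; simp
    · simp [h]
  have hoff : ∀ z, z ≠ y → φ (Pi.single x 1) z = 0 := by
    intro z hz
    have := congrFun hφ z
    simpa [hz] using this.symm
  have hid : IsIdempotentElem (φ (Pi.single x 1) y) := by
    have := congrArg φ hee
    rw [map_mul] at this
    exact congrFun this y
  refine ⟨x, ?_⟩
  rcases hR _ hid with h0 | h1
  · exfalso
    have hz : φ (Pi.single x 1) = φ 0 := by
      rw [map_zero]
      ext z
      by_cases h : z = y
      · subst h; simpa using h0
      · simpa using hoff z h
    have := congrFun (φ.injective hz) x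
    simp at this
  · ext z
    by_cases h : z = y
    · subst h; simpa using h1
    · simpa [h] using hoff z h

open Classical in
/-- If singleton `x` goes to singleton `y`, then `φ a` at `y` is `a x`. -/
theorem apply_of_single {R : Type*} [CommRing R]
    {P : Type*} (φ : (P → R) ≃ₐ[R] (P → R)) (x y : P)
    (h : φ (Pi.single x 1) = Pi.single y 1) (a : P → R) : φ a y = a x := by
  have h1 : Pi.single x 1 * a = a x • (Pi.single x 1 : P → R) := by
    ext z
    by_cases h : z = x
    · subst h; simp
    · simp [h]
  have h2 := congrArg φ h1
  rw [map_mul, map_smul, h] at h2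
  simpa using congrFun h2 y

/-- If `R` is a nontrivial commutative indecomposable ring, then every
surjective 2-local automorphism of `Π = ∏_{x ∈ P} R` is an `R`-algebra automorphism. -/
theorem stmt5 {R : Type*} [CommRing R] [Nontrivial R]
    (hR : ∀ r : R, IsIdempotentElem r → r = 0 ∨ r = 1)
    {P : Type*} (η : (P → R) →ₗ[R] (P → R))
    (hloc : ∀ a b : P → R, ∃ φ : (P → R) ≃ₐ[R] (P → R), η a = φ a ∧ η b = φ b)
    (hsurj : Function.Surjective η) :
    ∃ ψ : (P → R) ≃ₐ[R] (P → R), ⇑ψ = ⇑η := by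
  classical
  have key : ∀ y, ∃ x, ∀ a, η a y = a x := by
    intro y
    obtain ⟨f, hf⟩ := hsurj (Pi.single y 1)
    obtain ⟨φ, h1, -⟩ := hloc f f
    obtain ⟨x, hx⟩ := exists_single_preimage hR φ y
    have hfx : f = Pi.single x 1 := by
      apply φ.injective
      rw [← h1, hf]
      convert hx.symm
    refine ⟨x, fun a => ?_⟩
    obtain ⟨φ', h2, h3⟩ := hloc f a
    rw [h3]
    apply apply_of_single
    rw [hf, hfx] at h2
    convert h2.symm
  choose s hs using key
  have hinj : Function.Injective η := by
    intro a b hab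
    obtain ⟨φ, h1, h2⟩ := hloc a b
    exact φ.injective (by rw [← h1, ← h2, hab])
  have hone : η 1 = 1 := by ext y; simp [hs]
  have hmul : ∀ a b, η (a * b) = η a * η b := by intro a b; ext y; simp [hs]
  exact ⟨AlgEquiv.ofBijective (AlgHom.ofLinearMap η hone hmul) ⟨hinj, hsurj⟩, rfl⟩
end

section
/- Let P be a set of infinite cardinality κ and 𝔅 = (𝒫(P), △, ∩) the ℤ/2-algebra of subsets of P. Then there exist exactly 2^(2^κ) non-surjective local automorphisms of 𝔅, and there exist exactly 2^(2^κ) bijective local automorphisms of 𝔅 which are not ℤ/2-algebra automorphisms of 𝔅 (i.e., not of the form X ↦ ρ(X) for a permutation ρ of P). -/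
/-- A local automorphism of the `ℤ/2`-algebra `𝔅 = (𝒫(P), △, ∩)`: an additive map (with
respect to symmetric difference) that agrees argumentwise with an automorphism of `𝔅`,
i.e. with a map induced by a permutation of `P`. -/
def IsLocalAutB {P : Type*} (η : Set P → Set P) : Prop :=
  (∀ X Y : Set P, η (symmDiff X Y) = symmDiff (η X) (η Y)) ∧
    ∀ X : Set P, ∃ ρ : Equiv.Perm P, η X = ρ '' X

open Cardinal in
theorem aux_card_le {P : Type*} {A B : Set P} (hA : A.Infinite) (h : (symmDiff A B).Finite) :
    #B ≤ #A := by
  have h1 : B ⊆ A ∪ symmDiff A B := by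
    intro x hx
    by_cases hxa : x ∈ A
    · exact Or.inl hxa
    · exact Or.inr (Or.inr ⟨hx, hxa⟩)
  have hA' : ℵ₀ ≤ #A := by
    have := hA.to_subtype
    exact aleph0_le_mk _
  have h2 : #(symmDiff A B : Set P) ≤ #A := (h.lt_aleph0.le).trans hA'
  calc #B ≤ #(A ∪ symmDiff A B : Set P) := mk_le_mk_of_subset h1
    _ ≤ #A + #(symmDiff A B : Set P) := mk_union_le _ _
    _ = #A := add_eq_left hA' h2

open Cardinal in
theorem aux_card_eq {P : Type*} {A B : Set P} (hA : A.Infinite) (h : (symmDiff A B).Finite) :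
    #A = #B := by
  have hB : B.Infinite := by
    intro hB
    apply hA
    refine (hB.union h).subset ?_
    intro x hx
    by_cases hxa : x ∈ B
    · exact Or.inl hxa
    · exact Or.inr (Or.inl ⟨hx, hxa⟩)
  exact le_antisymm (aux_card_le hB (by rwa [symmDiff_comm])) (aux_card_le hA h)

open Cardinal in
theorem aux_perm {P : Type*} {A B : Set P} (h1 : #A = #B) (h2 : #(Aᶜ : Set P) = #(Bᶜ : Set P)) :
    ∃ ρ : Equiv.Perm P, B = ρ '' A := by
  classical
  obtain ⟨e⟩ := Cardinal.eq.1 h1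
  obtain ⟨e'⟩ := Cardinal.eq.1 h2
  let f : A ↪ P := e.toEmbedding.trans (Function.Embedding.subtype _)
  have hf : Set.range f = B := by
    ext x
    constructor
    · rintro ⟨y, rfl⟩
      exact (e y).2
    · intro hx
      exact ⟨e.symm ⟨x, hx⟩, by simp [f]⟩
  obtain ⟨g, hg⟩ := extend_function f (by rw [hf]; exact ⟨e'⟩)
  refine ⟨g, ?_⟩
  rw [← hf]
  ext x
  constructor
  · rintro ⟨y, rfl⟩
    exact ⟨y, y.2, hg y⟩
  · rintro ⟨y, hy, rfl⟩
    exact ⟨⟨y, hy⟩, (hg ⟨y, hy⟩).symm⟩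

open Cardinal in
theorem aux_loc {P : Type*} [Infinite P] (T : Set P → Set P) (f : P → P)
    (hf : Function.Injective f) (hr : ((Set.range f)ᶜ).Finite)
    (hadd : ∀ X Y : Set P, T (symmDiff X Y) = symmDiff (T X) (T Y))
    (hD : ∀ X, (symmDiff (f '' X) (T X)).Finite)
    (hfin : ∀ X : Set P, X.Finite → T X = f '' X)
    (huniv : T Set.univ = Set.univ) : IsLocalAutB T := by
  refine ⟨hadd, fun X => ?_⟩
  have hcompl : ∀ X, T Xᶜ = (T X)ᶜ := by
    intro X
    have : Xᶜ = symmDiff Set.univ X := by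
      ext x; simp [Set.mem_symmDiff]
    rw [this, hadd, huniv]
    ext x; simp [Set.mem_symmDiff]
  have hlt : ∀ X : Set P, X.Finite → #X < #P := fun X hX =>
    hX.lt_aleph0.trans_le (aleph0_le_mk P)
  have key : ∀ X : Set P, X.Finite → #X = #(T X) ∧ #(Xᶜ : Set P) = #((T X)ᶜ : Set P) := by
    intro X hX
    rw [hfin X hX]
    exact ⟨(mk_image_eq hf).symm,
      mk_compl_eq_mk_compl_infinite (hlt _ hX) (hlt _ (hX.image f))⟩
  by_cases h1 : X.Finite
  · exact aux_perm (key X h1).1 (key X h1).2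
  by_cases h2 : (Xᶜ).Finite
  · have := key _ h2
    rw [hcompl, compl_compl, compl_compl] at this
    exact aux_perm this.2 this.1
  have inf : ∀ X : Set P, X.Infinite → #X = #(T X) := by
    intro X hX
    rw [← aux_card_eq (hX.image hf.injOn) (hD X)]
    exact (mk_image_eq hf).symm
  refine aux_perm (inf _ h1) ?_
  rw [← hcompl]
  exact inf _ h2

noncomputable def auxInd {P : Type*} (X : Set P) : P → ZMod 2 := X.indicator 1

theorem auxInd_symmDiff {P : Type*} (X Y : Set P) :
    auxInd (symmDiff X Y) = auxInd X + auxInd Y := by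
  classical
  ext x
  by_cases h1 : x ∈ X <;> by_cases h2 : x ∈ Y <;>
    simp [auxInd, Set.indicator, Set.mem_symmDiff, h1, h2]
  decide

theorem auxInd_surj {P : Type*} (v : P → ZMod 2) : ∃ X : Set P, v = auxInd X := by
  classical
  refine ⟨{x | v x = 1}, ?_⟩
  ext x
  have : ∀ c : ZMod 2, c = if c = 1 then 1 else 0 := by decide
  simpa [auxInd, Set.indicator] using this (v x)

theorem auxInd_finite {P : Type*} [DecidableEq P] (l : (P → ZMod 2) →ₗ[ZMod 2] ZMod 2)
    (h0 : ∀ x, l (Pi.single x 1) = 0) (X : Set P) (hX : X.Finite) : l (auxInd X) = 0 := by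
  induction X, hX using Set.Finite.induction_on with
  | empty =>
    have : auxInd (∅ : Set P) = 0 := by
      ext x; simp [auxInd]
    rw [this, map_zero]
  | @insert a s ha hs ih =>
    have : auxInd (insert a s) = Pi.single a 1 + auxInd s := by
      ext x
      by_cases hx : x = a
      · subst hx; simp [auxInd, ha]
      · have hm : x ∈ insert a s ↔ x ∈ s := by
          rw [Set.mem_insert_iff]; tauto
        by_cases hs' : x ∈ s
        · simp [auxInd, hx, Set.indicator_of_mem hs', Set.indicator_of_mem (hm.2 hs')]
        · simp [auxInd, hx, Set.indicator_of_notMem hs',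
            Set.indicator_of_notMem (fun h => hs' (hm.1 h))]
    rw [this, map_add, ih, h0, add_zero]

def auxD {P : Type*} (a : P) (l : (P → ZMod 2) →ₗ[ZMod 2] ZMod 2) (X : Set P) : Set P :=
  {y | y = a ∧ l (auxInd X) = 1}

theorem auxD_symmDiff {P : Type*} (a : P) (l : (P → ZMod 2) →ₗ[ZMod 2] ZMod 2) (X Y : Set P) :
    auxD a l (symmDiff X Y) = symmDiff (auxD a l X) (auxD a l Y) := by
  ext y
  simp only [auxD, Set.mem_symmDiff, Set.mem_ofPred_eq, auxInd_symmDiff, map_add]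
  generalize l (auxInd X) = c
  generalize l (auxInd Y) = d
  have : ∀ c d : ZMod 2, c + d = 1 ↔ (c = 1 ∧ ¬ d = 1) ∨ (d = 1 ∧ ¬ c = 1) := by decide
  rw [this c d]
  tauto

theorem auxD_finite {P : Type*} (a : P) (l : (P → ZMod 2) →ₗ[ZMod 2] ZMod 2) (X : Set P) :
    (auxD a l X).Finite := (Set.finite_singleton a).subset (fun _ hy => hy.1)

theorem auxD_empty {P : Type*} (a : P) (l : (P → ZMod 2) →ₗ[ZMod 2] ZMod 2) (X : Set P)
    (h : l (auxInd X) = 0) : auxD a l X = ∅ := by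
  ext y
  simp [auxD, h]

theorem auxD_inj {P : Type*} (a : P) (l l' : (P → ZMod 2) →ₗ[ZMod 2] ZMod 2)
    (h : ∀ X, auxD a l X = auxD a l' X) : l = l' := by
  ext1 v
  obtain ⟨X, rfl⟩ := auxInd_surj v
  have h1 : l (auxInd X) = 1 ↔ l' (auxInd X) = 1 := by
    have := Set.ext_iff.1 (h X) a
    simpa [auxD] using this
  have : ∀ c d : ZMod 2, (c = 1 ↔ d = 1) → c = d := by decide
  exact this _ _ h1

/-- The perturbed map. -/
def auxT {P : Type*} (f : P → P) (a : P) (l : (P → ZMod 2) →ₗ[ZMod 2] ZMod 2) (X : Set P) :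
    Set P := symmDiff (f '' X) (auxD a l X)

theorem auxT_inj {P : Type*} (f : P → P) (a : P) (l l' : (P → ZMod 2) →ₗ[ZMod 2] ZMod 2)
    (h : auxT f a l = auxT f a l') : l = l' :=
  auxD_inj a l l' fun X => symmDiff_right_injective _ (congrFun h X)

theorem auxT_add {P : Type*} (f : P → P) (hf : Function.Injective f) (a : P)
    (l : (P → ZMod 2) →ₗ[ZMod 2] ZMod 2) (X Y : Set P) :
    auxT f a l (symmDiff X Y) = symmDiff (auxT f a l X) (auxT f a l Y) := by
  unfold auxT
  rw [Set.image_symmDiff hf, auxD_symmDiff, symmDiff_symmDiff_symmDiff_comm]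

theorem auxT_fin {P : Type*} [DecidableEq P] (f : P → P) (a : P)
    (l : (P → ZMod 2) →ₗ[ZMod 2] ZMod 2) (h0 : ∀ x, l (Pi.single x 1) = 0)
    (X : Set P) (hX : X.Finite) : auxT f a l X = f '' X := by
  unfold auxT
  rw [auxD_empty a l X (auxInd_finite l h0 X hX)]
  exact symmDiff_bot _

theorem auxT_loc {P : Type*} [Infinite P] [DecidableEq P] (f : P → P)
    (hf : Function.Injective f) (hr : ((Set.range f)ᶜ).Finite) (a : P)
    (l : (P → ZMod 2) →ₗ[ZMod 2] ZMod 2) (h0 : ∀ x, l (Pi.single x 1) = 0)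
    (huniv : auxT f a l Set.univ = Set.univ) : IsLocalAutB (auxT f a l) := by
  refine aux_loc _ f hf hr (auxT_add f hf a l) ?_ (auxT_fin f a l h0) huniv
  intro X
  unfold auxT
  rw [symmDiff_symmDiff_cancel_left]
  exact auxD_finite a l X

theorem auxInd_univ {P : Type*} : auxInd (Set.univ : Set P) = 1 := by
  simp [auxInd]

def auxW (P : Type*) [DecidableEq P] : Submodule (ZMod 2) (P → ZMod 2) :=
  Submodule.span (ZMod 2) (Set.range (fun x : P => Pi.single x 1) ∪ {1})

open Cardinal in
theorem aux_dual_card (P : Type*) [Infinite P] [DecidableEq P] :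
    #(((P → ZMod 2) ⧸ auxW P) →ₗ[ZMod 2] ZMod 2) = 2 ^ ((2 : Cardinal) ^ #P) := by
  have : Fact (Nat.Prime 2) := ⟨Nat.prime_two⟩
  have h2 : #(ZMod 2) = 2 := by simp [ZMod]
  have hV : Module.rank (ZMod 2) (P → ZMod 2) = 2 ^ #P := by
    rw [rank_fun_infinite]
    simp [h2]
  have hW : Module.rank (ZMod 2) (auxW P) ≤ #P := by
    refine (rank_span_le _).trans ((mk_union_le _ _).trans ?_)
    have := aleph0_le_mk P
    refine add_le_of_le this mk_range_le ?_
    rw [mk_singleton]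
    exact one_le_aleph0.trans this
  have hinf : ℵ₀ ≤ (2 : Cardinal) ^ #P := (aleph0_le_mk P).trans (cantor _).le
  have hQ : Module.rank (ZMod 2) ((P → ZMod 2) ⧸ auxW P) = 2 ^ #P := by
    have := rank_quotient_add_rank_of_divisionRing (auxW P)
    rw [hV, add_comm] at this
    exact eq_of_add_eq_of_aleph0_le this (hW.trans_lt (cantor _)) hinf
  let b := Module.Free.chooseBasis (ZMod 2) ((P → ZMod 2) ⧸ auxW P)
  rw [← mk_congr (b.constr (ZMod 2) (M' := ZMod 2)).toEquiv]
  rw [← hQ, ← b.mk_eq_rank'']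
  simp [h2]

open Cardinal in
theorem aux_upper (P : Type*) [Infinite P] (p : (Set P → Set P) → Prop) :
    #{η : Set P → Set P // p η} ≤ 2 ^ ((2 : Cardinal) ^ #P) := by
  refine (mk_subtype_le _).trans ?_
  have h := aleph0_le_mk P
  simp only [← power_def, mk_set]
  rw [← power_mul]
  have : #P * 2 ^ #P = 2 ^ #P := mul_eq_right (h.trans (cantor _).le) (cantor _).le
    (mk_ne_zero P)
  rw [this]

theorem aux_z2 : ∀ c : ZMod 2, c ≠ 0 → c = 1 := by decide

theorem aux_exists_functional (P : Type*) [Infinite P] [DecidableEq P] :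
    ∃ l : (P → ZMod 2) →ₗ[ZMod 2] ZMod 2, (∀ x, l (Pi.single x 1) = 0) ∧ l 1 = 1 := by
  have : Fact (Nat.Prime 2) := ⟨Nat.prime_two⟩
  have hnot : (1 : P → ZMod 2) ∉
      Submodule.span (ZMod 2) (Set.range (fun x : P => (Pi.single x 1 : P → ZMod 2))) := by
    intro h
    have key : ∀ v ∈ Submodule.span (ZMod 2)
        (Set.range (fun x : P => (Pi.single x 1 : P → ZMod 2))),
        (Function.support v).Finite := by
      intro v hv
      induction hv using Submodule.span_induction with
      | mem v hv =>
        obtain ⟨x, rfl⟩ := hv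
        refine (Set.finite_singleton x).subset ?_
        intro y hy
        by_contra hne
        exact hy (Pi.single_eq_of_ne hne _)
      | zero => simp
      | add v w _ _ h1 h2 => exact (h1.union h2).subset (Function.support_add v w)
      | smul c v _ h1 => exact h1.subset (Function.support_const_smul_subset c v)
    have := key _ h
    have h3 : Function.support (1 : P → ZMod 2) = Set.univ := by
      ext; simp
    rw [h3] at this
    exact Set.infinite_univ this
  obtain ⟨l, h1, h2⟩ := Submodule.exists_le_ker_of_notMem hnot
  refine ⟨l, fun x => h2 (Submodule.subset_span ⟨x, rfl⟩), ?_⟩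
  exact aux_z2 _ h1

theorem aux_quot {P : Type*} [DecidableEq P]
    (m : ((P → ZMod 2) ⧸ auxW P) →ₗ[ZMod 2] ZMod 2) :
    (∀ x, (m ∘ₗ (auxW P).mkQ) (Pi.single x 1) = 0) ∧ (m ∘ₗ (auxW P).mkQ) 1 = 0 := by
  constructor
  · intro x
    have : (auxW P).mkQ (Pi.single x 1) = 0 := by
      rw [Submodule.mkQ_apply, Submodule.Quotient.mk_eq_zero]
      exact Submodule.subset_span (Or.inl ⟨x, rfl⟩)
    rw [LinearMap.comp_apply, this, map_zero]
  · have : (auxW P).mkQ 1 = 0 := by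
      rw [Submodule.mkQ_apply, Submodule.Quotient.mk_eq_zero]
      exact Submodule.subset_span (Or.inr rfl)
    rw [LinearMap.comp_apply, this, map_zero]

theorem aux_quot_inj {P : Type*} [DecidableEq P]
    (m m' : ((P → ZMod 2) ⧸ auxW P) →ₗ[ZMod 2] ZMod 2)
    (h : m ∘ₗ (auxW P).mkQ = m' ∘ₗ (auxW P).mkQ) : m = m' :=
  Submodule.linearMap_qext _ h

theorem aux_part1 {P : Type*} [Infinite P] :
    Cardinal.mk {η : Set P → Set P // IsLocalAutB η ∧ ¬Function.Surjective η} =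
        (2 : Cardinal) ^ ((2 : Cardinal) ^ Cardinal.mk P) := by
  classical
  refine le_antisymm (aux_upper P _) ?_
  rw [← aux_dual_card P]
  obtain ⟨l0, hl0, hl1⟩ := aux_exists_functional P
  obtain ⟨a⟩ : Nonempty P := inferInstance
  have hc : Cardinal.mk P = Cardinal.mk (({a} : Set P)ᶜ : Set P) := by
    refine (Cardinal.mk_compl_of_infinite _ ?_).symm
    rw [Cardinal.mk_singleton]
    exact Cardinal.one_lt_aleph0.trans_le (Cardinal.aleph0_le_mk P)
  obtain ⟨e⟩ := Cardinal.eq.1 hc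
  let f : P → P := fun x => (e x : P)
  have hf : Function.Injective f := Subtype.val_injective.comp e.injective
  have hr : Set.range f = {a}ᶜ := by
    ext x
    constructor
    · rintro ⟨y, rfl⟩
      exact (e y).2
    · intro hx
      exact ⟨e.symm ⟨x, hx⟩, by simp [f]⟩
  have h0 : ∀ (m : ((P → ZMod 2) ⧸ auxW P) →ₗ[ZMod 2] ZMod 2) (x : P),
      (l0 + m ∘ₗ (auxW P).mkQ) (Pi.single x 1) = 0 := by
    intro m x
    rw [LinearMap.add_apply, hl0, (aux_quot m).1, add_zero]
  have h1 : ∀ (m : ((P → ZMod 2) ⧸ auxW P) →ₗ[ZMod 2] ZMod 2),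
      (l0 + m ∘ₗ (auxW P).mkQ) 1 = 1 := by
    intro m
    rw [LinearMap.add_apply, hl1, (aux_quot m).2, add_zero]
  have hloc : ∀ m : ((P → ZMod 2) ⧸ auxW P) →ₗ[ZMod 2] ZMod 2,
      IsLocalAutB (auxT f a (l0 + m ∘ₗ (auxW P).mkQ)) := by
    intro m
    refine auxT_loc f hf ?_ a _ (h0 m) ?_
    · rw [hr, compl_compl]
      exact Set.finite_singleton a
    · have hD : auxD a (l0 + m ∘ₗ (auxW P).mkQ) Set.univ = {a} := by
        ext y
        simp only [auxD, auxInd_univ, h1 m]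
        simp
      unfold auxT
      rw [hD, Set.image_univ, hr]
      exact compl_symmDiff_self _
  refine Cardinal.mk_le_of_injective
    (f := fun m => ⟨auxT f a (l0 + m ∘ₗ (auxW P).mkQ), hloc m, ?_⟩) ?_
  · intro hs
    obtain ⟨X, hX⟩ := hs {a}
    obtain ⟨ρ, hρ⟩ := (hloc m).2 X
    have hfin : X.Finite := by
      apply Set.Finite.of_finite_image (f := ρ) _ ρ.injective.injOn
      rw [← hρ, hX]
      exact Set.finite_singleton a
    rw [auxT_fin f a _ (h0 m) X hfin] at hX
    have : a ∈ f '' X := by rw [hX]; rfl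
    have h3 : a ∈ Set.range f := Set.image_subset_range _ _ this
    rw [hr] at h3
    exact h3 rfl
  · intro m m' h
    have h4 := auxT_inj f a _ _ (Subtype.ext_iff.1 h)
    exact aux_quot_inj m m' (add_left_cancel h4)

theorem aux_part2 {P : Type*} [Infinite P] :
    Cardinal.mk {η : Set P → Set P // IsLocalAutB η ∧ Function.Bijective η ∧
          ¬∃ ρ : Equiv.Perm P, η = fun X => ρ '' X} =
        (2 : Cardinal) ^ ((2 : Cardinal) ^ Cardinal.mk P) := by
  classical
  refine le_antisymm (aux_upper P _) ?_
  obtain ⟨a⟩ : Nonempty P := inferInstance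
  have hinf : Cardinal.aleph0 ≤
      Cardinal.mk (((P → ZMod 2) ⧸ auxW P) →ₗ[ZMod 2] ZMod 2) := by
    rw [aux_dual_card]
    exact ((Cardinal.aleph0_le_mk P).trans (Cardinal.cantor _).le).trans (Cardinal.cantor _).le
  have : Infinite (((P → ZMod 2) ⧸ auxW P) →ₗ[ZMod 2] ZMod 2) := Cardinal.aleph0_le_mk_iff.1 hinf
  rw [← aux_dual_card P, ← Cardinal.mk_compl_of_infinite
    ({0} : Set (((P → ZMod 2) ⧸ auxW P) →ₗ[ZMod 2] ZMod 2))
    (by rw [Cardinal.mk_singleton]; exact Cardinal.one_lt_aleph0.trans_le hinf)]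
  have hloc : ∀ m : ((P → ZMod 2) ⧸ auxW P) →ₗ[ZMod 2] ZMod 2,
      IsLocalAutB (auxT id a (m ∘ₗ (auxW P).mkQ)) := by
    intro m
    refine auxT_loc id Function.injective_id (by simp) a _ (aux_quot m).1 ?_
    unfold auxT
    rw [auxD_empty _ _ _ (by rw [auxInd_univ]; exact (aux_quot m).2), Set.image_id]
    exact symmDiff_bot _
  refine Cardinal.mk_le_of_injective
    (f := fun m => ⟨auxT id a (m.1 ∘ₗ (auxW P).mkQ), hloc m.1, ?_, ?_⟩) ?_
  · apply Function.Involutive.bijective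
    intro X
    have h1 : auxT id a (m.1 ∘ₗ (auxW P).mkQ) X
      = symmDiff X (auxD a (m.1 ∘ₗ (auxW P).mkQ) X) := by
      unfold auxT
      rw [Set.image_id]
    conv_lhs => rw [h1]
    rw [auxT_add id Function.injective_id, h1,
      auxT_fin id a _ (aux_quot m.1).1 _ (auxD_finite _ _ _), Set.image_id,
      symmDiff_symmDiff_cancel_right]
  · rintro ⟨ρ, hρ⟩
    have hid : ∀ x, ρ x = x := by
      intro x
      have h2 := congrFun hρ {x}
      rw [auxT_fin id a _ (aux_quot m.1).1 _ (Set.finite_singleton x)] at h2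
      simpa using h2.symm
    apply m.2
    refine aux_quot_inj m.1 0 (auxD_inj a _ _ fun X => ?_)
    have h3 := congrFun hρ X
    have h4 : ρ '' X = X := by
      simp [hid]
    simp only [h4] at h3
    unfold auxT at h3
    rw [Set.image_id] at h3
    rw [symmDiff_eq_left.1 h3, auxD_empty]
    · rfl
    · simp
  · intro m m' h
    have h4 := auxT_inj id a _ _ (Subtype.ext_iff.1 h)
    exact Subtype.ext (aux_quot_inj _ _ h4)

/-- For infinite `P` of cardinality `κ` there are exactly `2 ^ 2 ^ κ`
non-surjective local automorphisms of `𝔅`, and exactly `2 ^ 2 ^ κ` bijective local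
automorphisms of `𝔅` that are not `ℤ/2`-algebra automorphisms of `𝔅`. -/
theorem stmt7 {P : Type*} [Infinite P] :
    Cardinal.mk {η : Set P → Set P // IsLocalAutB η ∧ ¬Function.Surjective η} =
        (2 : Cardinal) ^ ((2 : Cardinal) ^ Cardinal.mk P) ∧
      Cardinal.mk {η : Set P → Set P // IsLocalAutB η ∧ Function.Bijective η ∧
          ¬∃ ρ : Equiv.Perm P, η = fun X => ρ '' X} =
        (2 : Cardinal) ^ ((2 : Cardinal) ^ Cardinal.mk P) :=
  ⟨aux_part1, aux_part2⟩
end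

section
/- Let R be a finite nontrivial commutative indecomposable ring and Π = ∏_{i∈ω} R the product R-algebra over a countably infinite index set. Then there exists a unital R-algebra endomorphism η of Π such that η is an n-local automorphism for every n ≥ 1, but η is not surjective; in particular, η is not an R-algebra automorphism of Π. -/
/-- A point extension of a colouring by a colour used infinitely often is a rearrangement. -/
theorem exists_perm_shift {C : Type*} (a : ℕ → C) (r : C) (h : {n | a n = r}.Infinite) :
    ∃ σ : ℕ ≃ ℕ, ∀ n, a (σ n) = (Nat.casesOn n r a : C) := by
  classical
  let b : ℕ → C := fun n => Nat.casesOn (motive := fun _ => C) n r a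
  have key : ∀ c : C, Nonempty ({n // b n = c} ≃ {n // a n = c}) := by
    intro c
    by_cases hc : c = r
    · subst hc
      have : Infinite {n // a n = c} := h.to_subtype
      have : Infinite {n // b n = c} :=
        Infinite.of_injective (fun x : {n // a n = c} => (⟨x.1 + 1, x.2⟩ : {n // b n = c}))
          (fun x y hxy => by
            have := congrArg Subtype.val hxy
            exact Subtype.ext (Nat.succ.inj this))
      have : Countable {n : ℕ // b n = c} := Subtype.countable
      exact nonempty_equiv_of_countable (α := {n : ℕ // b n = c}) (β := {n : ℕ // a n = c})
    · refine ⟨(Equiv.ofBijective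
        (fun x : {n // a n = c} => (⟨x.1 + 1, x.2⟩ : {n // b n = c})) ⟨?_, ?_⟩).symm⟩
      · intro x y hxy
        have := congrArg Subtype.val hxy
        exact Subtype.ext (Nat.succ.inj this)
      · rintro ⟨n, hn⟩
        cases n with
        | zero => exact absurd hn.symm hc
        | succ m => exact ⟨⟨m, hn⟩, rfl⟩
  let e := fun c => (key c).some
  refine ⟨(Equiv.sigmaFiberEquiv b).symm.trans
    ((Equiv.sigmaCongrRight e).trans (Equiv.sigmaFiberEquiv a)), fun n => ?_⟩
  exact (e (b n) ⟨n, rfl⟩).2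

/-- For a finite nontrivial commutative indecomposable ring `R` there is a
unital `R`-algebra endomorphism of `Π = ∏_{i ∈ ω} R` which is an `n`-local automorphism
for every `n`, but is not surjective (in particular, not an `R`-algebra automorphism). -/
theorem stmt9 {R : Type*} [CommRing R] [Nontrivial R] [Finite R]
    (hR : ∀ r : R, IsIdempotentElem r → r = 0 ∨ r = 1) :
    ∃ η : (ℕ → R) →ₐ[R] (ℕ → R),
      (∀ (n : ℕ) (a : Fin n → ℕ → R), ∃ φ : (ℕ → R) ≃ₐ[R] (ℕ → R),
        ∀ i : Fin n, η (a i) = φ (a i)) ∧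
      ¬Function.Surjective η ∧ ¬∃ ψ : (ℕ → R) ≃ₐ[R] (ℕ → R), ⇑ψ = ⇑η := by
  classical
  let U : Ultrafilter ℕ := Filter.hyperfilter ℕ
  have hL : ∀ a : ℕ → R, ∃ r, ∀ᶠ n in (U : Filter ℕ), a n = r := by
    intro a
    obtain ⟨r, hr⟩ := Ultrafilter.eq_pure_of_finite (U.map a)
    refine ⟨r, ?_⟩
    have : ({r} : Set R) ∈ U.map a := by rw [hr]; exact Ultrafilter.mem_pure.2 rfl
    exact this
  choose L hL using hL
  have huniq : ∀ a r, (∀ᶠ n in (U : Filter ℕ), a n = r) → L a = r := by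
    intro a r h
    obtain ⟨n, h1, h2⟩ := ((hL a).and h).exists
    exact h1.symm.trans h2
  let η : (ℕ → R) →ₐ[R] (ℕ → R) :=
    { toFun := fun a n => Nat.casesOn n (L a) a
      map_one' := by
        funext n
        cases n with
        | zero => exact huniq _ _ (Filter.Eventually.of_forall fun _ => rfl)
        | succ m => rfl
      map_zero' := by
        funext n
        cases n with
        | zero => exact huniq _ _ (Filter.Eventually.of_forall fun _ => rfl)
        | succ m => rfl
      map_mul' := by
        intro a b
        funext n
        cases n with
        | zero =>
          refine huniq _ _ ?_
          filter_upwards [hL a, hL b] with n h1 h2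
          simp [h1, h2]
        | succ m => rfl
      map_add' := by
        intro a b
        funext n
        cases n with
        | zero =>
          refine huniq _ _ ?_
          filter_upwards [hL a, hL b] with n h1 h2
          simp [h1, h2]
        | succ m => rfl
      commutes' := by
        intro r
        funext n
        cases n with
        | zero => exact huniq _ _ (Filter.Eventually.of_forall fun _ => rfl)
        | succ m => rfl }
  have hns : ¬Function.Surjective η := by
    intro hs
    obtain ⟨a, ha⟩ := hs (Pi.single 0 1)
    have h0 : a = 0 := by
      funext n
      have : η a (n + 1) = 0 := by rw [ha]; simp
      exact this
    have h1 : η a 0 = 1 := by rw [ha]; simp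
    rw [h0, map_zero] at h1
    exact zero_ne_one h1
  refine ⟨η, ?_, hns, ?_⟩
  · intro n a
    have hev : ∀ᶠ k in (U : Filter ℕ), ∀ i, a i k = L (a i) :=
      Filter.eventually_all.2 fun i => hL (a i)
    have hinf : {k | (fun i => a i k) = fun i => L (a i)}.Infinite := by
      intro hfin
      refine Filter.notMem_hyperfilter_of_finite hfin ?_
      filter_upwards [hev] with k hk
      exact funext hk
    obtain ⟨σ, hσ⟩ := exists_perm_shift (fun k i => a i k) (fun i => L (a i)) hinf
    refine ⟨AlgEquiv.piCongrLeft' R (fun _ : ℕ => R) σ.symm, ?_⟩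
    intro i
    funext k
    have hk := congrFun (hσ k) i
    cases k with
    | zero => exact hk.symm
    | succ m => exact hk.symm
  · rintro ⟨ψ, hψ⟩
    exact hns (hψ ▸ ψ.surjective)
end

section
/- Let R be an infinite nontrivial commutative indecomposable ring, P a set, Π = ∏_{x∈P} R, and γ : Π → R an R-linear map such that γ(a) ∈ {a_x : x ∈ P} for every a ∈ Π and γ(e_x) = 0 for every x ∈ P. Then the family U = {X ⊆ P : γ(e_X) = 1} is a non-principal ultrafilter on P which is closed under intersections of any family of at most |R| of its members; in particular, such an ultrafilter on P exists. -/
universe u v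

/-- An ultrafilter `U` on `P` is closed under intersections of any family of at most `|R|`
of its members. -/
def UFClosedUnderInter (R : Type u) {P : Type v} (U : Ultrafilter P) : Prop :=
  ∀ S : Set (Set P),
    Cardinal.lift.{u} (Cardinal.mk ↥S) ≤ Cardinal.lift.{v} (Cardinal.mk R) →
      (∀ X ∈ S, X ∈ U) → ⋂₀ S ∈ U

/-- If `R` is an infinite nontrivial commutative indecomposable ring and
`γ : Π → R` is an `R`-linear map with `γ(a) ∈ {a_x : x ∈ P}` for all `a` and `γ(e_x) = 0`
for all `x`, then `{X ⊆ P : γ(e_X) = 1}` is a non-principal ultrafilter on `P` closed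
under intersections of families of at most `|R|` of its members. -/
theorem stmt10 {R : Type u} [CommRing R] [Nontrivial R] [Infinite R]
    (hR : ∀ r : R, IsIdempotentElem r → r = 0 ∨ r = 1)
    {P : Type v} (γ : (P → R) →ₗ[R] R)
    (hval : ∀ a : P → R, ∃ x : P, γ a = a x)
    (hzero : ∀ x : P, γ (Set.indicator {x} 1) = 0) :
    ∃ U : Ultrafilter P,
      (∀ X : Set P, X ∈ U ↔ γ (Set.indicator X 1) = 1) ∧
      (¬∃ p : P, ∀ X : Set P, X ∈ U ↔ p ∈ X) ∧
      UFClosedUnderInter R U := by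
  classical
  have hind : ∀ (X : Set P) (x : P), Set.indicator X (1 : P → R) x = if x ∈ X then 1 else 0 := by
    intro X x
    simp [Set.indicator_apply]
  have h01 : ∀ X : Set P, γ (Set.indicator X 1) = 0 ∨ γ (Set.indicator X 1) = 1 := by
    intro X
    obtain ⟨x, hx⟩ := hval (Set.indicator X 1)
    rw [hx, hind]
    split_ifs <;> simp
  have h1 : γ 1 = 1 := by
    obtain ⟨x, hx⟩ := hval 1
    simpa using hx
  have hadd : ∀ X Y : Set P, Disjoint X Y →
      γ (Set.indicator (X ∪ Y) 1) = γ (Set.indicator X 1) + γ (Set.indicator Y 1) := by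
    intro X Y h
    rw [Set.indicator_union_of_disjoint h, ← map_add]
    rfl
  have hcompl : ∀ X : Set P, γ (Set.indicator X 1) + γ (Set.indicator Xᶜ 1) = 1 := by
    intro X
    rw [← hadd X Xᶜ disjoint_compl_right, Set.union_compl_self, Set.indicator_univ, h1]
  have hdisj : ∀ X Y : Set P, Disjoint X Y → γ (Set.indicator X 1) = 1 →
      γ (Set.indicator Y 1) = 1 → False := by
    intro X Y h hX hY
    have hU : γ (Set.indicator (X ∪ Y) 1) = 1 + 1 := by rw [hadd X Y h, hX, hY]
    have h2 : (1 : R) + 1 = 0 := by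
      rcases h01 (X ∪ Y) with h' | h'
      · rw [← hU, h']
      · rw [h'] at hU
        simp at hU
    have hZ : γ (Set.indicator (X ∪ Y)ᶜ 1) = 1 := by
      have := hcompl (X ∪ Y)
      rwa [hU, h2, zero_add] at this
    obtain ⟨t, ht⟩ := Infinite.exists_notMem_finset ({0, 1} : Finset R)
    simp only [Finset.mem_insert, Finset.mem_singleton, not_or] at ht
    obtain ⟨x, hx⟩ := hval (Set.indicator Y 1 + t • Set.indicator (X ∪ Y)ᶜ 1)
    rw [map_add, map_smul, hY, hZ, Pi.add_apply, Pi.smul_apply, hind, hind] at hx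
    simp only [smul_eq_mul, mul_one, Set.mem_compl_iff, Set.mem_union] at hx
    by_cases hxY : x ∈ Y
    · simp [hxY] at hx
      exact ht.1 hx
    · by_cases hxX : x ∈ X
      · simp [hxY, hxX] at hx
        apply ht.2
        linear_combination hx - h2
      · simp [hxY, hxX] at hx
  have hcm : ∀ X : Set P, γ (Set.indicator X 1) ≠ 1 → γ (Set.indicator Xᶜ 1) = 1 := by
    intro X hX
    have := hcompl X
    rwa [(h01 X).resolve_right hX, zero_add] at this
  have hmono : ∀ X Y : Set P, γ (Set.indicator X 1) = 1 → X ⊆ Y →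
      γ (Set.indicator Y 1) = 1 := by
    intro X Y hX hXY
    by_contra hY
    exact hdisj X Yᶜ (Set.disjoint_compl_right_iff_subset.2 hXY) hX (hcm Y hY)
  have hinter : ∀ X Y : Set P, γ (Set.indicator X 1) = 1 → γ (Set.indicator Y 1) = 1 →
      γ (Set.indicator (X ∩ Y) 1) = 1 := by
    intro X Y hX hY
    by_contra hI
    have h0 := (h01 _).resolve_right hI
    have hs : ∀ A B : Set P, γ (Set.indicator (A ∩ B) 1) = 0 → γ (Set.indicator A 1) = 1 →
        γ (Set.indicator (A \ B) 1) = 1 := by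
      intro A B hAB hA
      have := hadd (A ∩ B) (A \ B) Set.disjoint_sdiff_inter.symm
      rw [Set.inter_union_diff, hAB, hA, zero_add] at this
      exact this.symm
    exact hdisj (X \ Y) (Y \ X) disjoint_sdiff_sdiff (hs X Y h0 hX)
      (hs Y X (by rwa [Set.inter_comm]) hY)
  let F : Filter P :=
    { sets := {X | γ (Set.indicator X 1) = 1}
      univ_sets := by simpa using h1
      sets_of_superset := fun {X Y} hX h => hmono X Y hX h
      inter_sets := fun {X Y} hX hY => hinter X Y hX hY }
  have hF : ∀ X : Set P, X ∈ F ↔ γ (Set.indicator X 1) = 1 := fun X => Iff.rfl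
  let U : Ultrafilter P := Ultrafilter.ofComplNotMemIff F (by
    intro X
    rw [hF, hF]
    constructor
    · intro h
      have := hcm _ h
      rwa [compl_compl] at this
    · intro h h'
      exact hdisj X Xᶜ disjoint_compl_right h h')
  have hU : ∀ X : Set P, X ∈ U ↔ γ (Set.indicator X 1) = 1 := fun X => Iff.rfl
  refine ⟨U, hU, ?_, ?_⟩
  · rintro ⟨p, hp⟩
    have := (hU _).1 ((hp {p}).2 rfl)
    rw [hzero] at this
    exact zero_ne_one this
  · intro S hS hSU
    obtain ⟨g⟩ := Cardinal.lift_mk_le'.1 hS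
    by_contra hI
    have hfib : ∀ a : P → R, {x | a x = γ a} ∈ U := by
      intro a
      rw [hU]
      by_contra hne
      have h0 := (h01 _).resolve_right hne
      obtain ⟨x, hx⟩ := hval (a - γ a • 1 + Set.indicator {x | a x = γ a} 1)
      rw [map_add, map_sub, map_smul, h1, h0, Pi.add_apply, Pi.sub_apply, Pi.smul_apply,
        hind] at hx
      simp only [smul_eq_mul, mul_one, Pi.one_apply, sub_self, Set.mem_setOf_eq, add_zero] at hx
      split_ifs at hx with hax
      · rw [hax] at hx
        simp at hx
      · rw [add_zero] at hx
        exact hax (sub_eq_zero.1 hx.symm)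
    have hex : ∀ x ∈ (⋂₀ S)ᶜ, ∃ X : S, x ∉ X.1 := by
      intro x hx
      simpa using hx
    let c : P → R := fun x => if h : ∃ X : S, x ∉ X.1 then g h.choose else 0
    have hA := Filter.inter_mem (hfib c) (Ultrafilter.compl_mem_iff_notMem.2 hI)
    obtain ⟨x, hx1, hx2⟩ := U.nonempty_of_mem hA
    have ex := hex x hx2
    have hB := Filter.inter_mem hA (hSU _ ex.choose.2)
    obtain ⟨y, ⟨hy1, hy2⟩, hy3⟩ := U.nonempty_of_mem hB
    have ey := hex y hy2
    have hxy : c x = c y := hx1.trans hy1.symm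
    simp only [c, dif_pos ex, dif_pos ey] at hxy
    have := g.injective hxy
    apply ey.choose_spec
    rw [← this]
    exact hy3
end

section
/- Let R be a nontrivial commutative indecomposable ring and P a set carrying a non-principal ultrafilter closed under intersections of any family of at most |R| of its members. Then there exists a unital R-algebra endomorphism η of Π = ∏_{x∈P} R such that η is an n-local automorphism for every n ≥ 1, but η is not surjective; in particular, η is not an R-algebra automorphism of Π. -/
universe u v

theorem aux_lim {R : Type u} {P : Type v} (U : Ultrafilter P)
    (hc : UFClosedUnderInter R U) (a : P → R) : ∃ r : R, {x | a x = r} ∈ U := by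
  by_contra! h
  have h2 := hc (Set.range fun r : R => {x | a x = r}ᶜ) Cardinal.mk_range_le_lift (by
    rintro _ ⟨r, rfl⟩
    exact Ultrafilter.compl_mem_iff_notMem.2 (h r))
  have h3 : ⋂₀ (Set.range fun r : R => {x | a x = r}ᶜ) = ∅ := by
    ext x
    simp
  rw [h3] at h2
  exact U.empty_notMem h2

theorem aux_inf {P : Type v} (U : Ultrafilter P)
    (hn : ¬∃ p : P, ∀ X : Set P, X ∈ U ↔ p ∈ X) (X : Set P) (hX : X ∈ U) : X.Infinite := by
  intro hf
  obtain ⟨p, -, hp⟩ := Ultrafilter.eq_pure_of_finite_mem hf hX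
  exact hn ⟨p, fun Y => by rw [hp]; exact Ultrafilter.mem_pure⟩

theorem aux_option (X : Type v) [Infinite X] : Nonempty (Option X ≃ X) := by
  rw [← Cardinal.eq, Cardinal.mk_option]
  exact Cardinal.add_one_eq (Cardinal.aleph0_le_mk X)

/-- Absorb one point into an infinite subset. -/
theorem aux_equiv {P : Type v} (X : Set P) (hX : X.Infinite) :
    ∃ g : Option P ≃ P, g none ∈ X ∧ ∀ p, (p ∈ X ∧ g (some p) ∈ X) ∨ g (some p) = p := by
  classical
  have := hX.to_subtype
  obtain ⟨h⟩ := aux_option X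
  let f : Option P → P := fun o => match o with
    | none => h none
    | some p => if hp : p ∈ X then h (some ⟨p, hp⟩) else p
  have f0 : f none = h none := rfl
  have f1 : ∀ p (hp : p ∈ X), f (some p) = h (some ⟨p, hp⟩) := fun p hp => dif_pos hp
  have f2 : ∀ p (hp : p ∉ X), f (some p) = p := fun p hp => dif_neg hp
  have hb : Function.Bijective f := by
    constructor
    · have key : ∀ o : Option P, f o ∈ X → ∃ o' : Option X, o = o'.map Subtype.val ∧ f o = h o' := by
        intro o ho
        cases o with
        | none => exact ⟨none, rfl, f0⟩
        | some p =>
          by_cases hp : p ∈ X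
          · exact ⟨some ⟨p, hp⟩, rfl, f1 p hp⟩
          · rw [f2 p hp] at ho
            exact absurd ho hp
      have key2 : ∀ o : Option P, f o ∉ X → o = some (f o) := by
        intro o ho
        cases o with
        | none => exact absurd (h none).2 ho
        | some p =>
          by_cases hp : p ∈ X
          · rw [f1 p hp] at ho
            exact absurd (h _).2 ho
          · rw [f2 p hp]
      intro o₁ o₂ he
      by_cases hm : f o₁ ∈ X
      · obtain ⟨q₁, e₁, e₁'⟩ := key o₁ hm
        obtain ⟨q₂, e₂, e₂'⟩ := key o₂ (he ▸ hm)
        have : q₁ = q₂ := h.injective (Subtype.ext (by rw [← e₁', ← e₂', he]))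
        rw [e₁, e₂, this]
      · rw [key2 o₁ hm, key2 o₂ (he ▸ hm), he]
    · intro p
      by_cases hp : p ∈ X
      · obtain ⟨o, ho⟩ := h.surjective ⟨p, hp⟩
        cases o with
        | none => exact ⟨none, by rw [f0, ho]⟩
        | some q => exact ⟨some q, by rw [f1 q q.2, ho]⟩
      · exact ⟨some p, f2 p hp⟩
  refine ⟨Equiv.ofBijective f hb, (h none).2, fun p => ?_⟩
  by_cases hp : p ∈ X
  · left
    refine ⟨hp, ?_⟩
    rw [Equiv.ofBijective_apply, f1 p hp]
    exact (h _).2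
  · right
    exact f2 p hp

/-- If `P` carries a non-principal ultrafilter closed under intersections of
families of at most `|R|` of its members, then there is a unital `R`-algebra endomorphism
of `Π = ∏_{x ∈ P} R` which is an `n`-local automorphism for every `n` but is not
surjective (in particular, not an `R`-algebra automorphism). -/
theorem stmt12 {R : Type u} [CommRing R] [Nontrivial R]
    (hR : ∀ r : R, IsIdempotentElem r → r = 0 ∨ r = 1)
    {P : Type v}
    (hU : ∃ U : Ultrafilter P,
      (¬∃ p : P, ∀ X : Set P, X ∈ U ↔ p ∈ X) ∧ UFClosedUnderInter R U) :
    ∃ η : (P → R) →ₐ[R] (P → R),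
      (∀ (n : ℕ) (a : Fin n → P → R), ∃ φ : (P → R) ≃ₐ[R] (P → R),
        ∀ i : Fin n, η (a i) = φ (a i)) ∧
      ¬Function.Surjective η ∧ ¬∃ ψ : (P → R) ≃ₐ[R] (P → R), ⇑ψ = ⇑η := by
  obtain ⟨U, hn, hc⟩ := hU
  choose L hL using aux_lim U hc
  have hLu : ∀ (a : P → R) (r : R), {x | a x = r} ∈ U → L a = r := by
    intro a r h
    obtain ⟨x, h1, h2⟩ := U.nonempty_of_mem (Filter.inter_mem (hL a) h)
    exact h1.symm.trans h2
  have hinf := aux_inf U hn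
  have : Infinite P := Set.infinite_univ_iff.1 (hinf _ Filter.univ_mem)
  obtain ⟨e'⟩ := aux_option P
  let e := e'.symm
  let F : (P → R) → P → R := fun a p => (e p).elim (L a) a
  have hconst : ∀ r : R, L (fun _ => r) = r := fun r => hLu _ _ (Filter.mem_of_superset Filter.univ_mem fun _ _ => rfl)
  have hadd : ∀ a b, L (a + b) = L a + L b := fun a b => hLu _ _ (by
    filter_upwards [hL a, hL b] with x h1 h2
    exact congrArg₂ (· + ·) (show a x = L a from h1) (show b x = L b from h2))
  have hmul : ∀ a b, L (a * b) = L a * L b := fun a b => hLu _ _ (by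
    filter_upwards [hL a, hL b] with x h1 h2
    exact congrArg₂ (· * ·) (show a x = L a from h1) (show b x = L b from h2))
  have hFc : ∀ r : R, F (fun _ => r) = fun _ => r := by
    intro r
    funext p
    simp only [F]
    cases e p with
    | none => exact hconst r
    | some q => rfl
  let η : (P → R) →ₐ[R] (P → R) :=
    { toFun := F
      map_one' := hFc 1
      map_zero' := hFc 0
      map_add' := by
        intro a b
        funext p
        simp only [F, Pi.add_apply]
        cases e p with
        | none => exact hadd a b
        | some q => rfl
      map_mul' := by
        intro a b
        funext p
        simp only [F, Pi.mul_apply]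
        cases e p with
        | none => exact hmul a b
        | some q => rfl
      commutes' := fun r => hFc r }
  have hη : ∀ a p, η a p = (e p).elim (L a) a := fun _ _ => rfl
  have hns : ¬Function.Surjective η := by
    intro hs
    obtain ⟨a, ha⟩ := hs (fun p => (e p).elim 1 (fun _ => 0))
    have h1 : L a = 1 := by
      have := congrFun ha (e.symm none)
      simpa [hη] using this
    have h0 : a = fun _ => 0 := by
      funext q
      have := congrFun ha (e.symm (some q))
      simpa [hη] using this
    rw [h0, hconst] at h1
    exact zero_ne_one h1
  refine ⟨η, ?_, hns, ?_⟩
  · intro n a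
    have hX : {x | ∀ i, a i x = L (a i)} ∈ U := by
      have : ∀ᶠ x in (U : Filter P), ∀ i, a i x = L (a i) :=
        Filter.eventually_all.2 fun i => hL (a i)
      exact this
    obtain ⟨g, g0, g1⟩ := aux_equiv _ (hinf _ hX)
    let σ : P ≃ P := e.trans g
    refine ⟨AlgEquiv.ofAlgHom
      (AlgHom.ofLinearMap (LinearMap.funLeft R R σ) rfl (fun _ _ => rfl))
      (AlgHom.ofLinearMap (LinearMap.funLeft R R σ.symm) rfl (fun _ _ => rfl)) ?_ ?_, ?_⟩
    · ext b p
      exact congrArg b (σ.symm_apply_apply p)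
    · ext b p
      exact congrArg b (σ.apply_symm_apply p)
    · intro i
      funext p
      change (e p).elim (L (a i)) (a i) = a i (g (e p))
      cases e p with
      | none => exact (g0 i).symm
      | some q =>
        rcases g1 q with ⟨h1, h2⟩ | h
        · exact (h1 i).trans (h2 i).symm
        · rw [h]
          rfl
  · rintro ⟨ψ, hψ⟩
    exact hns (hψ ▸ ψ.surjective)
end

section
/- Let R be a nontrivial commutative indecomposable ring and P a set. Then every local automorphism of Π = ∏_{x∈P} R is an R-algebra automorphism of Π if and only if there is no non-principal ultrafilter on P closed under intersections of any family of at most |R| of its members. -/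
universe u v

open Classical in
/-- Indicator function. -/
noncomputable def ind (R : Type u) [CommRing R] {P : Type v} (X : Set P) : P → R :=
  fun x => if x ∈ X then 1 else 0

open Classical in
theorem aut_perm {R : Type u} [CommRing R] [Nontrivial R]
    (hR : ∀ r : R, IsIdempotentElem r → r = 0 ∨ r = 1)
    {P : Type v} (φ : (P → R) ≃ₐ[R] (P → R)) :
    ∃ σ : Equiv.Perm P, ∀ a x, φ a x = a (σ x) := by
  have key : ∀ y, ∃ x, φ (Pi.single x 1) = Pi.single y 1 := by
    intro y
    have hid : φ.symm (Pi.single y 1) * φ.symm (Pi.single y 1) = φ.symm (Pi.single y 1) := by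
      rw [← map_mul, ← Pi.single_mul, one_mul]
    have hne : φ.symm (Pi.single y 1) ≠ 0 := by
      intro h
      have h2 : (Pi.single y 1 : P → R) = 0 := by simpa using h
      have := congrFun h2 y
      simp at this
    obtain ⟨x, hx⟩ := Function.ne_iff.1 hne
    have hx1 : φ.symm (Pi.single y 1) x = 1 := by
      rcases hR _ (congrFun hid x) with h | h
      · exact absurd h hx
      · exact h
    refine ⟨x, ?_⟩
    have e1 : (Pi.single x 1 : P → R) * φ.symm (Pi.single y 1) = Pi.single x 1 := by
      ext z
      by_cases hz : z = x
      · subst hz; simp [hx1]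
      · simp [hz]
    have e2 : φ (Pi.single x 1) * Pi.single y 1 = φ (Pi.single x 1) := by
      have := congrArg φ e1
      simpa using this
    have e3 : φ (Pi.single x 1) * φ (Pi.single x 1) = φ (Pi.single x 1) := by
      rw [← map_mul, ← Pi.single_mul, one_mul]
    have e4 : ∀ z, z ≠ y → φ (Pi.single x 1) z = 0 := by
      intro z hz
      have := congrFun e2 z
      simpa [hz] using this.symm
    rcases hR _ (congrFun e3 y) with h | h
    · exfalso
      have h0 : φ (Pi.single x 1) = 0 := by
        ext z
        by_cases hz : z = y
        · subst hz; simpa using h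
        · simpa using e4 z hz
      have h2 : (Pi.single x 1 : P → R) = 0 := by simpa using h0
      have := congrFun h2 x
      simp at this
    · ext z
      by_cases hz : z = y
      · subst hz; simpa using h
      · simpa [hz] using e4 z hz
  choose σ hσ using key
  have hev : ∀ a x, φ a x = a (σ x) := by
    intro a x
    have e : a * Pi.single (σ x) 1 = a (σ x) • (Pi.single (σ x) 1 : P → R) := by
      ext z
      by_cases hz : z = σ x
      · subst hz; simp
      · simp [hz]
    have := congrFun (congrArg φ e) x
    simpa [hσ] using this
  refine ⟨Equiv.ofBijective σ ⟨?_, ?_⟩, hev⟩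
  · intro x y h
    have h1 := hσ x
    rw [h, hσ y] at h1
    by_contra hne
    have := congrFun h1 y
    simp [Ne.symm hne] at this
  · intro x
    by_contra hx
    have h0 : φ (Pi.single x 1) = 0 := by
      ext z
      rw [hev]
      have : σ z ≠ x := fun h => hx ⟨z, h⟩
      simp [this]
    have h2 : (Pi.single x 1 : P → R) = 0 := by simpa using h0
    have := congrFun h2 x
    simp at this

theorem perm_aut (R : Type u) [CommRing R] {P : Type v} (σ : Equiv.Perm P) :
    ∃ φ : (P → R) ≃ₐ[R] (P → R), ∀ a x, φ a x = a (σ x) :=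
  ⟨{ toFun := fun a x => a (σ x)
     invFun := fun a x => a (σ.symm x)
     left_inv := fun a => by ext x; simp
     right_inv := fun a => by ext x; simp
     map_mul' := fun _ _ => rfl
     map_add' := fun _ _ => rfl
     commutes' := fun _ => rfl }, fun _ _ => rfl⟩

/-- A linear functional taking values in the range is evaluation at a point. -/
theorem func_eval {R : Type u} [CommRing R] [Nontrivial R] [Infinite R] {P : Type v}
    (hU : ¬∃ U : Ultrafilter P,
        (¬∃ p : P, ∀ X : Set P, X ∈ U ↔ p ∈ X) ∧ UFClosedUnderInter R U)
    (χ : (P → R) →ₗ[R] R) (hχ : ∀ a, ∃ x, χ a = a x) : ∃ q, ∀ a, χ a = a q := by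
  classical
  have hind : ∀ X : Set P, χ (ind R X) = 0 ∨ χ (ind R X) = 1 := by
    intro X
    obtain ⟨x, hx⟩ := hχ (ind R X)
    rw [hx]; unfold ind; split_ifs <;> simp
  have h1 : χ (fun _ => 1) = 1 := by
    obtain ⟨x, hx⟩ := hχ (fun _ => 1); exact hx
  have hdisj : ∀ X Y : Set P, Disjoint X Y → χ (ind R X) = 1 → χ (ind R Y) = 1 → False := by
    intro X Y hXY hX hY
    obtain ⟨r, hr⟩ := Infinite.exists_notMem_finset ({0, -1} : Finset R)
    simp only [Finset.mem_insert, Finset.mem_singleton, not_or] at hr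
    obtain ⟨x, hx⟩ := hχ (ind R X + r • ind R Y)
    rw [map_add, map_smul, hX, hY] at hx
    have hd : ¬ (x ∈ X ∧ x ∈ Y) := fun h => Set.disjoint_left.1 hXY h.1 h.2
    by_cases a : x ∈ X <;> by_cases b : x ∈ Y
    · exact hd ⟨a, b⟩
    · simp [ind, a, b] at hx; exact hr.1 hx
    · simp [ind, a, b] at hx
    · simp [ind, a, b] at hx
      exact hr.2 (by linear_combination hx)
  have hadd : ∀ X Y : Set P, Disjoint X Y → χ (ind R (X ∪ Y)) = χ (ind R X) + χ (ind R Y) := by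
    intro X Y hXY
    rw [← map_add]
    congr 1
    ext x
    have hd : ¬ (x ∈ X ∧ x ∈ Y) := fun h => Set.disjoint_left.1 hXY h.1 h.2
    by_cases a : x ∈ X <;> by_cases b : x ∈ Y <;> simp_all [ind]
  have huniv : χ (ind R Set.univ) = 1 := by
    rw [← h1]; congr 1; ext x; simp [ind]
  have hempty : χ (ind R (∅ : Set P)) = 0 := by
    have : ind R (∅ : Set P) = 0 := by ext x; simp [ind]
    rw [this, map_zero]
  have hmono : ∀ X Y : Set P, X ⊆ Y → χ (ind R X) = 1 → χ (ind R Y) = 1 := by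
    intro X Y h hX
    have := hadd X (Y \ X) Set.disjoint_sdiff_right
    rw [Set.union_sdiff_cancel h, hX] at this
    rcases hind (Y \ X) with h0 | h0
    · rw [this, h0, add_zero]
    · exact (hdisj _ _ Set.disjoint_sdiff_right hX h0).elim
  have hinter : ∀ X Y : Set P, χ (ind R X) = 1 → χ (ind R Y) = 1 → χ (ind R (X ∩ Y)) = 1 := by
    intro X Y hX hY
    have := hadd (X ∩ Y) (X \ Y) (Set.disjoint_sdiff_inter.symm)
    rw [Set.inter_union_sdiff, hX] at this
    rcases hind (X \ Y) with h0 | h0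
    · rw [this, h0, add_zero]
    · exact (hdisj _ _ Set.disjoint_sdiff_left h0 hY).elim
  have hcompl : ∀ X : Set P, χ (ind R X) + χ (ind R Xᶜ) = 1 := by
    intro X
    rw [← hadd _ _ disjoint_compl_right, Set.union_compl_self, huniv]
  let F : Filter P :=
    { sets := {X | χ (ind R X) = 1}
      univ_sets := huniv
      sets_of_superset := fun {X Y} hX h => hmono X Y h hX
      inter_sets := fun {X Y} hX hY => hinter X Y hX hY }
  have hF : ∀ X, X ∈ F ↔ χ (ind R X) = 1 := fun X => Iff.rfl
  let U : Ultrafilter P := Ultrafilter.ofComplNotMemIff F (by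
    intro X
    rw [hF, hF]
    have h := hcompl X
    rcases hind X with h0 | h0
    · rw [h0, zero_add] at h; simp [h0, h]
    · rw [h0] at h
      have : χ (ind R Xᶜ) = 0 := by linear_combination h
      simp [h0, this])
  have hUm : ∀ X, X ∈ U ↔ χ (ind R X) = 1 := fun X => Iff.rfl
  have hval : ∀ a, {x | a x = χ a} ∈ U := by
    intro a
    by_contra hn
    have hz : χ (ind R {x | a x = χ a}) = 0 := (hind _).resolve_right hn
    obtain ⟨x, hx⟩ := hχ (a - χ a • (fun _ => 1) + ind R {x | a x = χ a})
    rw [map_add, map_sub, map_smul, h1, hz] at hx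
    by_cases h : a x = χ a
    · simp [ind, h] at hx
    · simp [ind, h] at hx
      exact h (by linear_combination -hx)
  have hclosed : UFClosedUnderInter R U := by
    intro S hS hmem
    obtain ⟨f⟩ := Cardinal.lift_mk_le'.1 hS
    by_contra hn
    have hc : (⋂₀ S)ᶜ ∈ U := Ultrafilter.compl_mem_iff_notMem.2 hn
    have hch : ∀ x : P, ∃ r : R, x ∈ (⋂₀ S)ᶜ → ∃ s : S, f s = r ∧ x ∉ s.1 := by
      intro x
      by_cases hx : x ∈ (⋂₀ S)ᶜ
      · have : ∃ s ∈ S, x ∉ s := by simpa using hx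
        obtain ⟨s, hs, hxs⟩ := this
        exact ⟨f ⟨s, hs⟩, fun _ => ⟨⟨s, hs⟩, rfl, hxs⟩⟩
      · exact ⟨0, fun h => absurd h hx⟩
    choose a ha using hch
    have hm := Filter.inter_mem (hval a) hc
    obtain ⟨x, hx1, hx2⟩ := U.nonempty_of_mem hm
    obtain ⟨s, hs, hxs⟩ := ha x hx2
    have hm2 := Filter.inter_mem hm (hmem s.1 s.2)
    obtain ⟨y, ⟨hy1, hy2⟩, hy3⟩ := U.nonempty_of_mem hm2
    obtain ⟨t, ht, hyt⟩ := ha y hy2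
    have : t = s := f.injective (by rw [ht, hs]; exact (hy1.trans hx1.symm))
    rw [this] at hyt
    exact hyt hy3
  have hprin : ∃ p : P, ∀ X : Set P, X ∈ U ↔ p ∈ X := by
    by_contra h
    exact hU ⟨U, h, hclosed⟩
  obtain ⟨q, hq⟩ := hprin
  exact ⟨q, fun a => ((hq _).1 (hval a)).symm⟩

theorem dir_back {R : Type u} [CommRing R] [Nontrivial R]
    (hR : ∀ r : R, IsIdempotentElem r → r = 0 ∨ r = 1) {P : Type v}
    (hU : ¬∃ U : Ultrafilter P,
        (¬∃ p : P, ∀ X : Set P, X ∈ U ↔ p ∈ X) ∧ UFClosedUnderInter R U)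
    (η : (P → R) →ₗ[R] (P → R))
    (hη : ∀ a : P → R, ∃ φ : (P → R) ≃ₐ[R] (P → R), η a = φ a) :
    ∃ ψ : (P → R) ≃ₐ[R] (P → R), ⇑ψ = ⇑η := by
  classical
  have hσ : ∀ a, ∃ σ : Equiv.Perm P, ∀ x, η a x = a (σ x) := by
    intro a
    obtain ⟨φ, hφ⟩ := hη a
    obtain ⟨σ, hs⟩ := aut_perm hR φ
    exact ⟨σ, fun x => by rw [hφ, hs]⟩
  suffices h : ∃ τ : Equiv.Perm P, ∀ a x, η a x = a (τ x) by
    obtain ⟨τ, hτ⟩ := h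
    obtain ⟨ψ, hψ⟩ := perm_aut R τ
    exact ⟨ψ, by ext a x; rw [hψ, hτ]⟩
  rcases finite_or_infinite P with hP | hP
  · have := Fintype.ofFinite P
    have h1 : ∀ y, ∃ x, η (Pi.single y 1) = Pi.single x 1 := by
      intro y
      obtain ⟨σ, hs⟩ := hσ (Pi.single y 1)
      refine ⟨σ.symm y, ?_⟩
      ext z
      rw [hs]
      simp [Pi.single_apply, Equiv.eq_symm_apply]
    choose τ hτ using h1
    have hinj : Function.Injective τ := by
      intro x y hxy
      obtain ⟨σ, hs⟩ := hσ (Pi.single x 1 - Pi.single y 1)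
      have h := hs (σ.symm x)
      rw [map_sub, hτ, hτ, hxy] at h
      by_contra hne
      simp [hne] at h
    have hb := Finite.injective_iff_bijective.1 hinj
    refine ⟨(Equiv.ofBijective τ hb).symm, fun a x => ?_⟩
    have ha : a = ∑ y, a y • (Pi.single y 1 : P → R) := by
      ext z
      simp [Finset.sum_apply, Pi.single_apply]
    obtain ⟨y, rfl⟩ := hb.2 x
    have hy : (Equiv.ofBijective τ hb).symm (τ y) = y := by
      rw [Equiv.symm_apply_eq]; rfl
    rw [hy]
    conv_lhs => rw [ha]
    rw [map_sum]
    simp [hτ, Finset.sum_apply, Pi.single_apply, hinj.eq_iff]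
  · have hRi : Infinite R := by
      by_contra hf
      have hf : Finite R := not_infinite_iff_finite.1 hf
      refine hU ⟨Filter.hyperfilter P, ?_, ?_⟩
      · rintro ⟨p, hp⟩
        have := (hp {p}).2 rfl
        exact Filter.notMem_hyperfilter_of_finite (Set.finite_singleton p) this
      · intro S hS hm
        obtain ⟨f⟩ := Cardinal.lift_mk_le'.1 hS
        have : Finite S := Finite.of_injective f f.injective
        exact (Filter.sInter_mem (Set.toFinite S)).2 hm
    have h1 : ∀ p, ∃ q, ∀ a, η a p = a q := by
      intro p
      exact func_eval hU ((LinearMap.proj p).comp η) (fun a => by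
        obtain ⟨σ, hs⟩ := hσ a
        exact ⟨σ p, hs p⟩)
    choose τ hτ using h1
    refine ⟨Equiv.ofBijective τ ⟨?_, ?_⟩, fun a x => hτ x a⟩
    · intro x y hxy
      obtain ⟨σ, hs⟩ := hσ (Pi.single (τ x) 1)
      have hx := hs x
      have hy := hs y
      rw [hτ] at hx hy
      rw [← hxy] at hy
      have key : ∀ z, (1 : R) = (Pi.single (τ x) 1 : P → R) z → z = τ x := by
        intro z hz
        by_contra hne
        simp [hne] at hz
      rw [Pi.single_eq_same] at hx hy
      exact σ.injective ((key _ hx).trans (key _ hy).symm)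
    · intro q
      by_contra hq
      obtain ⟨σ, hs⟩ := hσ (Pi.single q 1)
      have h := hs (σ.symm q)
      rw [hτ] at h
      have hne : τ (σ.symm q) ≠ q := fun h => hq ⟨_, h⟩
      simp [hne] at h

theorem dir_fwd {R : Type u} [CommRing R] [Nontrivial R]
    (hR : ∀ r : R, IsIdempotentElem r → r = 0 ∨ r = 1) {P : Type v}
    (U : Ultrafilter P) (hU : ¬∃ p : P, ∀ X : Set P, X ∈ U ↔ p ∈ X)
    (hc : UFClosedUnderInter R U) :
    ∃ η : (P → R) →ₗ[R] (P → R),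
      (∀ a : P → R, ∃ φ : (P → R) ≃ₐ[R] (P → R), η a = φ a) ∧
        ¬ ∃ ψ : (P → R) ≃ₐ[R] (P → R), ⇑ψ = ⇑η := by
  classical
  have hfin : ∀ X ∈ U, Set.Infinite X := by
    intro X hX hf
    obtain ⟨p, _, hp⟩ := Ultrafilter.eq_pure_of_finite_mem hf hX
    exact hU ⟨p, fun Y => by rw [hp]; exact Iff.rfl⟩
  have hex : ∀ a : P → R, ∃ r, {x | a x = r} ∈ U := by
    intro a
    by_contra! hn
    have hm := hc (Set.range fun r : R => {x | a x = r}ᶜ) Cardinal.mk_range_le_lift (by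
      rintro _ ⟨r, rfl⟩
      exact Ultrafilter.compl_mem_iff_notMem.2 (hn r))
    obtain ⟨x, hx⟩ := U.nonempty_of_mem hm
    exact hx _ ⟨a x, rfl⟩ rfl
  choose L hL using hex
  have huniq : ∀ a r, {x | a x = r} ∈ U → L a = r := by
    intro a r h
    obtain ⟨x, h1, h2⟩ := U.nonempty_of_mem (Filter.inter_mem (hL a) h)
    exact h1.symm.trans h2
  have hinfP : Infinite P := Set.infinite_univ_iff.1 (hfin _ Filter.univ_mem)
  have hopt : ∀ (T : Type v) [Infinite T], Nonempty (T ≃ Option T) := by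
    intro T _
    rw [← Cardinal.eq, Cardinal.mk_option]
    exact (Cardinal.add_one_eq (Cardinal.aleph0_le_mk T)).symm
  obtain ⟨f⟩ := hopt P
  let ext : (P → R) → Option P → R := fun a o => o.elim (L a) a
  let η : (P → R) →ₗ[R] (P → R) :=
    { toFun := fun a p => ext a (f p)
      map_add' := by
        intro a b
        funext p
        change ext (a + b) (f p) = ext a (f p) + ext b (f p)
        rcases f p with _ | x
        · apply huniq
          filter_upwards [hL a, hL b] with x hx hy
          change a x + b x = L a + L b
          rw [hx, hy]
        · rfl
      map_smul' := by
        intro r a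
        funext p
        change ext (r • a) (f p) = r * ext a (f p)
        rcases f p with _ | x
        · apply huniq
          filter_upwards [hL a] with x hx
          change r * a x = r * L a
          rw [hx]
        · rfl }
  refine ⟨η, ?_, ?_⟩
  · intro a
    have hXi : Infinite {x | a x = L a} := (hfin _ (hL a)).to_subtype
    obtain ⟨g⟩ := hopt {x | a x = L a}
    have hfib : ∀ r : R, Nonempty ({o : Option P // ext a o = r} ≃ {x : P // a x = r}) := by
      intro r
      by_cases hr : r = L a
      · subst hr
        refine ⟨Equiv.trans ?_ g.symm⟩
        refine
          { toFun := fun o => match o with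
              | ⟨none, _⟩ => none
              | ⟨some x, h⟩ => some ⟨x, h⟩
            invFun := fun o => match o with
              | none => ⟨none, rfl⟩
              | some x => ⟨some x.1, x.2⟩
            left_inv := ?_
            right_inv := ?_ }
        · rintro ⟨_ | x, h⟩ <;> rfl
        · rintro (_ | x) <;> rfl
      · refine ⟨
          { toFun := fun o => match o with
              | ⟨none, h⟩ => absurd h.symm hr
              | ⟨some x, h⟩ => ⟨x, h⟩
            invFun := fun x => ⟨some x.1, x.2⟩
            left_inv := ?_
            right_inv := ?_ }⟩
        · rintro ⟨_ | x, h⟩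
          · exact absurd h.symm hr
          · rfl
        · intro x; rfl
    let e : Option P ≃ P := Equiv.ofFiberEquiv (f := ext a) (g := a) fun r => (hfib r).some
    have he : ∀ o, a (e o) = ext a o := Equiv.ofFiberEquiv_map _
    obtain ⟨φ, hφ⟩ := perm_aut R (f.trans e)
    refine ⟨φ, ?_⟩
    funext x
    rw [hφ]
    exact (he _).symm
  · rintro ⟨ψ, hψ⟩
    obtain ⟨σ, hσ⟩ := aut_perm hR ψ
    have h : ∀ a, L a = a (σ (f.symm none)) := by
      intro a
      rw [← hσ a, hψ]
      change _ = ext a (f (f.symm none))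
      rw [f.apply_symm_apply]
      rfl
    refine hU ⟨σ (f.symm none), fun X => ?_⟩
    have h2 := h (ind R X)
    constructor
    · intro hX
      have : L (ind R X) = 1 := huniq _ _ (by
        filter_upwards [hX] with x hx
        simp [ind, hx])
      rw [this] at h2
      by_contra hn
      simp [ind, hn] at h2
    · intro hX
      have h3 := hL (ind R X)
      rw [h2] at h3
      filter_upwards [h3] with x hx
      by_contra hn
      simp [ind, hn, hX] at hx

theorem stmt13 {R : Type u} [CommRing R] [Nontrivial R]
    (hR : ∀ r : R, IsIdempotentElem r → r = 0 ∨ r = 1)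
    {P : Type v} :
    (∀ η : (P → R) →ₗ[R] (P → R),
      (∀ a : P → R, ∃ φ : (P → R) ≃ₐ[R] (P → R), η a = φ a) →
        ∃ ψ : (P → R) ≃ₐ[R] (P → R), ⇑ψ = ⇑η) ↔
      ¬∃ U : Ultrafilter P,
        (¬∃ p : P, ∀ X : Set P, X ∈ U ↔ p ∈ X) ∧ UFClosedUnderInter R U := by
  constructor
  · rintro h ⟨U, hU, hc⟩
    obtain ⟨η, h1, h2⟩ := dir_fwd hR U hU hc
    exact h2 (h η h1)
  · intro hU η hη
    exact dir_back hR hU η hη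
end

section
/- Let R be a nontrivial commutative indecomposable ring, P a set, Π = ∏_{x∈P} R, and η an R-algebra endomorphism of Π (an R-linear multiplicative map, not necessarily unital). Suppose that for each x ∈ P there is a subset A_x ⊆ P with η(e_x) = e_{A_x}, and that P = ⋃_{x∈P} A_x. Then the sets A_x are pairwise disjoint and η is induced by the family {A_x : x ∈ P}, i.e., for every a ∈ Π and every y ∈ P one has (η a)_y = a_x whenever y ∈ A_x. -/
/-- Let `η` be an `R`-algebra endomorphism (linear and multiplicative, not
necessarily unital) of `Π = ∏_{x ∈ P} R` with `η(e_x) = e_{A_x}` for subsets `A_x ⊆ P`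
covering `P`. Then the `A_x` are pairwise disjoint and `η` is induced by them. -/
theorem stmt14 {R : Type*} [CommRing R] [Nontrivial R]
    (hR : ∀ r : R, IsIdempotentElem r → r = 0 ∨ r = 1)
    {P : Type*} (η : (P → R) →ₗ[R] (P → R))
    (hmul : ∀ a b : P → R, η (a * b) = η a * η b)
    (A : P → Set P)
    (hA : ∀ x : P, η (Set.indicator {x} 1) = Set.indicator (A x) 1)
    (hcover : (⋃ x : P, A x) = Set.univ) :
    (Pairwise fun x y => Disjoint (A x) (A y)) ∧
      ∀ (a : P → R) (x y : P), y ∈ A x → η a y = a x := by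
  refine ⟨?_, ?_⟩
  · intro x y hxy
    rw [Set.disjoint_left]
    intro z hzx hzy
    have h0 : (Set.indicator {x} 1 * Set.indicator {y} 1 : P → R) = 0 := by
      funext w
      by_cases hw : w = x
      · subst hw
        simp [hxy]
      · simp [hw]
    have h := congrFun (hmul (Set.indicator {x} 1) (Set.indicator {y} 1)) z
    rw [h0, hA, hA, map_zero] at h
    simp [hzx, hzy] at h
  · intro a x y hy
    have h0 : (a * Set.indicator {x} 1 : P → R) = a x • Set.indicator {x} 1 := by
      funext w
      by_cases hw : w = x
      · subst hw
        simp
      · simp [hw]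
    have h := congrFun (hmul a (Set.indicator {x} 1)) y
    rw [h0, map_smul, hA] at h
    simpa [hy] using h.symm
end

section
/- Let R be a nontrivial commutative indecomposable ring and P a set carrying a non-principal ultrafilter closed under intersections of any family of at most |R| of its members. Then there exists an injective unital R-algebra endomorphism η of Π = ∏_{x∈P} R which is not induced, i.e., there is no family {A_x : x ∈ P} of pairwise disjoint subsets of P with (η a)_y = a_x for y ∈ A_x and (η a)_y = 0 for y ∉ ⋃_{x∈P} A_x, for all a ∈ Π. -/
universe u v

/-- A map `η : Π → Π` on `Π = ∏_{x ∈ P} R` is induced if there is a family of pairwise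
disjoint subsets `A_x ⊆ P` with `(η a)_y = a_x` for `y ∈ A_x` and `(η a)_y = 0` for
`y ∉ ⋃ A_x`. -/
def InducedEndo {R : Type u} {P : Type v} [Zero R] (η : (P → R) → (P → R)) : Prop :=
  ∃ A : P → Set P, (Pairwise fun x y => Disjoint (A x) (A y)) ∧
    ∀ a : P → R, (∀ x : P, ∀ y ∈ A x, η a y = a x) ∧
      ∀ y : P, y ∉ (⋃ x : P, A x) → η a y = 0

theorem exists_ulim {R : Type u} {P : Type v} (U : Ultrafilter P)
    (hU : UFClosedUnderInter R U) (a : P → R) : ∃ r : R, {x | a x = r} ∈ U := by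
  by_contra hcon
  push Not at hcon
  have h := hU (Set.range fun r : R => {x | a x = r}ᶜ) Cardinal.mk_range_le_lift (by
    rintro X ⟨r, rfl⟩
    exact Ultrafilter.compl_mem_iff_notMem.2 (hcon r))
  have h0 : ⋂₀ (Set.range fun r : R => {x | a x = r}ᶜ) = ∅ := by
    ext x
    simp
  rw [h0] at h
  exact U.empty_notMem h

theorem ulim_unique {R : Type u} {P : Type v} (U : Ultrafilter P) (a : P → R) {r s : R}
    (hr : {x | a x = r} ∈ U) (hs : {x | a x = s} ∈ U) : r = s := by
  obtain ⟨x, hx, hy⟩ := U.nonempty_of_mem (Filter.inter_mem hr hs)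
  exact hx.symm.trans hy

/-- If `P` carries a non-principal ultrafilter closed under intersections of
families of at most `|R|` of its members, then `Π = ∏_{x ∈ P} R` has an injective unital
`R`-algebra endomorphism which is not induced. -/
theorem stmt16 {R : Type u} [CommRing R] [Nontrivial R]
    (hR : ∀ r : R, IsIdempotentElem r → r = 0 ∨ r = 1)
    {P : Type v}
    (hU : ∃ U : Ultrafilter P,
      (¬∃ p : P, ∀ X : Set P, X ∈ U ↔ p ∈ X) ∧ UFClosedUnderInter R U) :
    ∃ η : (P → R) →ₐ[R] (P → R), Function.Injective η ∧ ¬InducedEndo ⇑η := by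
  classical
  obtain ⟨U, hnp, hc⟩ := hU
  choose L hL using exists_ulim U hc
  have hLe : ∀ a r, {x | a x = r} ∈ U → L a = r := fun a r h => ulim_unique U a (hL a) h
  have hinf : Infinite P := by
    by_contra hfin
    rw [not_infinite_iff_finite] at hfin
    obtain ⟨p, hp⟩ := Ultrafilter.eq_pure_of_finite U
    exact hnp ⟨p, fun X => by rw [hp]; exact Ultrafilter.mem_pure⟩
  obtain ⟨e⟩ : Nonempty (P ≃ Option P) := by
    apply Cardinal.eq.1
    rw [Cardinal.mk_option, Cardinal.add_one_eq (Cardinal.aleph0_le_mk P)]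
  let lim : (P → R) →ₐ[R] R :=
    { toFun := L
      map_one' := hLe _ _ (Filter.univ_mem' fun _ => rfl)
      map_zero' := hLe _ _ (Filter.univ_mem' fun _ => rfl)
      map_mul' := fun a b => hLe _ _ (by
        filter_upwards [hL a, hL b] with x hx hy
        simp [hx, hy])
      map_add' := fun a b => hLe _ _ (by
        filter_upwards [hL a, hL b] with x hx hy
        simp [hx, hy])
      commutes' := fun r => hLe _ _ (Filter.univ_mem' fun _ => rfl) }
  let η : (P → R) →ₐ[R] (P → R) :=
    AlgHom.pi fun y => (e y).elim lim fun x => Pi.evalAlgHom R (fun _ => R) x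
  have hsome : ∀ a x, η a (e.symm (some x)) = a x := fun a x => by simp [η]
  have hnone : ∀ a, η a (e.symm none) = L a := fun a => by simp [η, lim]
  refine ⟨η, ?_, ?_⟩
  · intro a b hab
    ext x
    rw [← hsome a, ← hsome b, hab]
  · rintro ⟨A, -, hA⟩
    by_cases hy : e.symm none ∈ ⋃ x, A x
    · obtain ⟨x, hx⟩ := Set.mem_iUnion.1 hy
      have h1 := (hA (Pi.single x 1)).1 x _ hx
      rw [hnone, Pi.single_eq_same] at h1
      have h2 := hL (Pi.single x 1)
      rw [h1] at h2
      have h3 : {x} ∈ U := by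
        filter_upwards [h2] with z hz
        by_contra hne
        rw [Pi.single_eq_of_ne hne] at hz
        exact zero_ne_one hz
      refine hnp ⟨x, fun X => ⟨fun hX => ?_, fun hX => ?_⟩⟩
      · obtain ⟨z, hz, hz'⟩ := U.nonempty_of_mem (Filter.inter_mem hX h3)
        rw [Set.mem_singleton_iff] at hz'
        exact hz' ▸ hz
      · exact Filter.mem_of_superset h3 (Set.singleton_subset_iff.2 hX)
    · have := (hA 1).2 _ hy
      rw [map_one] at this
      exact one_ne_zero this
end

section
/- Let R be a commutative ring with identity, (P, ≤) a locally finite partially ordered set, X ⊆ P, and a an idempotent element of the incidence algebra I(P) of P over R whose diagonal is the indicator of X, i.e., a(x,x) = 1 for x ∈ X and a(x,x) = 0 for x ∈ P \ X. Then for all y ≤ z in P, a(y,z) ≠ 0 implies that y ≤ x ≤ z for some x ∈ X. -/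
/-- If `a` is an idempotent of the incidence algebra of a locally finite
poset `P` over `R` whose diagonal is the indicator of `X ⊆ P`, then every nonzero entry
`a y z` (with `y ≤ z`) satisfies `y ≤ x ≤ z` for some `x ∈ X`. -/
theorem stmt18 {R : Type*} [CommRing R] {P : Type*} [PartialOrder P]
    [LocallyFiniteOrder P] [DecidableEq P]
    (X : Set P) (a : IncidenceAlgebra R P) (ha : a * a = a)
    (hdiag1 : ∀ x ∈ X, a x x = 1) (hdiag0 : ∀ (x : P), x ∉ X → a x x = 0) :
    ∀ y z : P, y ≤ z → a y z ≠ 0 → ∃ x ∈ X, y ≤ x ∧ x ≤ z := by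
  have key : ∀ n : ℕ, ∀ y z : P, (Finset.Icc y z).card = n → y ≤ z →
      (∀ x ∈ X, y ≤ x → ¬ x ≤ z) → a y z = 0 := by
    intro n
    induction n using Nat.strong_induction_on with
    | _ n ih =>
      intro y z hn hyz hX
      rw [← ha, IncidenceAlgebra.mul_apply]
      refine Finset.sum_eq_zero fun w hw => ?_
      obtain ⟨hyw, hwz⟩ := Finset.mem_Icc.1 hw
      by_cases h : y = w
      · subst h
        rw [hdiag0 y (fun hy => hX y hy le_rfl hyz), zero_mul]
      · have hss : Finset.Icc w z ⊂ Finset.Icc y z := by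
          refine Finset.ssubset_iff_subset_ne.2 ⟨Finset.Icc_subset_Icc_left hyw, fun he => ?_⟩
          have hy : y ∈ Finset.Icc w z := by
            rw [he]
            exact Finset.mem_Icc.2 ⟨le_rfl, hyz⟩
          exact h (le_antisymm hyw (Finset.mem_Icc.1 hy).1)
        rw [ih _ (hn ▸ Finset.card_lt_card hss) w z rfl hwz
          (fun x hx hwx => hX x hx (hyw.trans hwx)), mul_zero]
  intro y z hyz hne
  by_contra hcon
  exact hne (key _ y z rfl hyz fun x hx h1 h2 => hcon ⟨x, hx, h1, h2⟩)
end

section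
/- Let R be a nontrivial commutative indecomposable ring, (P, ≤) a finite partially ordered set, and η a local automorphism of the incidence algebra I(P) of P over R. Then there exists an order automorphism ρ of (P, ≤) such that for every a ∈ I(P) one has η(a) − ρ̂(a) ∈ Z, where Z is the ideal of elements of I(P) with zero diagonal; equivalently, (η a)(ρ(x), ρ(x)) = a(x, x) for all a ∈ I(P) and all x ∈ P. -/
namespace LocAut

set_option linter.unusedSectionVars false

open Finset

variable {R : Type*} [CommRing R] {P : Type*} [PartialOrder P] [Fintype P] [DecidableEq P]
  [LocallyFiniteOrder P]

open Classical in
/-- matrix units -/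
noncomputable def E (R : Type*) [CommRing R] {P : Type*} [PartialOrder P] (x y : P) :
    IncidenceAlgebra R P :=
  ⟨fun a b => if a = x ∧ b = y ∧ x ≤ y then 1 else 0, by
    intro a b h
    rw [if_neg]
    rintro ⟨rfl, rfl, h'⟩
    exact h h'⟩

open Classical in
lemma E_apply (x y a b : P) : E R x y a b = if a = x ∧ b = y ∧ x ≤ y then 1 else 0 := by
  unfold E
  simp only [IncidenceAlgebra.coe_mk]
  congr

lemma E_diag (x a : P) : E R x x a a = if a = x then 1 else 0 := by
  simp [E_apply]

lemma E_off (x y a : P) (h : x ≠ y) : E R x y a a = 0 := by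
  rw [E_apply, if_neg]
  rintro ⟨rfl, rfl, _⟩
  exact h rfl

lemma E_mul (x a b : P) (f : IncidenceAlgebra R P) :
    (E R x x * f) a b = if a = x then f x b else 0 := by
  rw [IncidenceAlgebra.mul_apply]
  split_ifs with h
  · subst h
    by_cases hab : a ≤ b
    · rw [Finset.sum_eq_single a]
      · simp [E_apply]
      · intro z _ hz
        simp [E_apply, hz]
      · simp [hab]
    · rw [IncidenceAlgebra.apply_eq_zero_of_not_le hab, Finset.Icc_eq_empty hab, sum_empty]
  · apply Finset.sum_eq_zero
    intro z _
    simp [E_apply, h]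

lemma mul_E (x a b : P) (f : IncidenceAlgebra R P) :
    (f * E R x x) a b = if b = x then f a x else 0 := by
  rw [IncidenceAlgebra.mul_apply]
  split_ifs with h
  · subst h
    by_cases hab : a ≤ b
    · rw [Finset.sum_eq_single b]
      · simp [E_apply]
      · intro z _ hz
        simp [E_apply, hz]
      · simp [hab]
    · rw [IncidenceAlgebra.apply_eq_zero_of_not_le hab, Finset.Icc_eq_empty hab, sum_empty]
  · apply Finset.sum_eq_zero
    intro z _
    simp [E_apply, h]

lemma E_mul_E (x y : P) : E R x x * E R x y = E R x y := by
  ext a b _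
  rw [E_mul]
  split_ifs with h
  · rw [h]
  · simp [E_apply, h]

lemma E_mul_E' (x y : P) : E R x y * E R y y = E R x y := by
  ext a b _
  rw [mul_E]
  split_ifs with h
  · rw [h]
  · simp [E_apply, h]

lemma E_mul_E_ne (x y : P) (hxy : x ≠ y) : E R x y * E R x x = 0 := by
  ext a b _
  rw [mul_E]
  simp [E_apply, hxy]

lemma E_mul_E_diag (x y : P) (hxy : x ≠ y) : E R x x * E R y y = 0 := by
  ext a b _
  rw [mul_E]
  simp [E_apply, hxy.symm]

lemma E_idem (x : P) : E R x x * E R x x = E R x x := E_mul_E x x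

/-- evaluation at an entry -/
def ev (x y : P) : IncidenceAlgebra R P →ₗ[R] R where
  toFun a := a x y
  map_add' _ _ := rfl
  map_smul' _ _ := rfl

lemma ev_apply (x y : P) (a : IncidenceAlgebra R P) : ev x y a = a x y := rfl

lemma decomp (a : IncidenceAlgebra R P) : a = ∑ x, ∑ y, a x y • E R x y := by
  ext p q hpq
  rw [← ev_apply (R := R) p q (∑ x, ∑ y, a x y • E R x y)]
  simp only [map_sum, map_smul, ev_apply]
  rw [Finset.sum_eq_single p, Finset.sum_eq_single q]
  · simp [E_apply, hpq]
  · intro z _ hz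
    simp [E_apply, hz.symm]
  · simp
  · intro z _ hz
    simp [E_apply, hz.symm]
  · simp

lemma lin_diag (L : IncidenceAlgebra R P →ₗ[R] R) (hL : ∀ x y, x ≠ y → L (E R x y) = 0)
    (a : IncidenceAlgebra R P) : L a = ∑ x, a x x * L (E R x x) := by
  conv_lhs => rw [decomp a]
  simp only [map_sum, map_smul, smul_eq_mul]
  refine Finset.sum_congr rfl fun x _ => ?_
  rw [Finset.sum_eq_single x]
  · intro y _ hy
    rw [hL x y hy.symm, mul_zero]
  · simp

lemma char_eq [Nontrivial R] (hR : ∀ r : R, IsIdempotentElem r → r = 0 ∨ r = 1)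
    (χ : IncidenceAlgebra R P →ₐ[R] R) : ∃ x, ∀ a, χ a = a x x := by
  have h0 : ∀ x y, x ≠ y → χ (E R x y) = 0 := by
    intro x y h
    rw [← E_mul_E, map_mul, mul_comm, ← map_mul, E_mul_E_ne x y h, map_zero]
  have hd : ∀ a, χ a = ∑ x, a x x * χ (E R x x) := lin_diag χ.toLinearMap h0
  have hid : ∀ x, χ (E R x x) = 0 ∨ χ (E R x x) = 1 := by
    intro x
    apply hR
    unfold IsIdempotentElem
    rw [← map_mul, E_idem]
  have hex : ∃ x, χ (E R x x) = 1 := by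
    by_contra hne
    push Not at hne
    have h1 := hd 1
    rw [map_one, Finset.sum_eq_zero] at h1
    · exact one_ne_zero h1
    · intro x _
      rw [(hid x).resolve_right (hne x), mul_zero]
  obtain ⟨x, hx⟩ := hex
  refine ⟨x, fun a => ?_⟩
  rw [hd, Finset.sum_eq_single x]
  · rw [hx, mul_one]
  · intro z _ hz
    have : χ (E R z z) = 0 := by
      have := congrArg χ (E_mul_E_diag (R := R) z x hz)
      rwa [map_mul, hx, mul_one, map_zero] at this
    rw [this, mul_zero]
  · simp

/-- diagonal evaluation as an algebra hom -/
def dg (y : P) : IncidenceAlgebra R P →ₐ[R] R :=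
  AlgHom.ofLinearMap (ev y y) (by simp [ev_apply]) (by intro a b; simp [ev_apply])

lemma dg_apply (y : P) (a : IncidenceAlgebra R P) : dg y a = a y y := rfl

lemma idem_left (u : IncidenceAlgebra R P) (hu : u * u = u) (s : P)
    (hs : ∀ p, p ≠ s → u p p = 0) (p : P) (hp : ¬ p ≤ s) (q : P) : u p q = 0 := by
  induction q using WellFoundedLT.induction with
  | ind q ih =>
    by_cases hpq : p ≤ q
    · rw [← hu, IncidenceAlgebra.mul_apply]
      apply Finset.sum_eq_zero
      intro z hz
      rw [Finset.mem_Icc] at hz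
      rcases hz.2.eq_or_lt with h | h
      · subst h
        rw [hs z (fun h => hp (h ▸ hpq)), mul_zero]
      · rw [ih z h, zero_mul]
    · exact IncidenceAlgebra.apply_eq_zero_of_not_le hpq _

lemma idem_right (u : IncidenceAlgebra R P) (hu : u * u = u) (s : P)
    (hs : ∀ p, p ≠ s → u p p = 0) (q : P) (hq : ¬ s ≤ q) (p : P) : u p q = 0 := by
  induction p using WellFoundedGT.induction with
  | ind p ih =>
    by_cases hpq : p ≤ q
    · rw [← hu, IncidenceAlgebra.mul_apply]
      apply Finset.sum_eq_zero
      intro z hz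
      rw [Finset.mem_Icc] at hz
      rcases hz.1.eq_or_lt with h | h
      · subst h
        rw [hs p (fun h => hq (h ▸ hpq)), zero_mul]
      · rw [ih z h, mul_zero]
    · exact IncidenceAlgebra.apply_eq_zero_of_not_le hpq _

lemma idem_mul (u g v : IncidenceAlgebra R P) (hu : u * u = u) (hv : v * v = v) (s t : P)
    (hs : ∀ p, p ≠ s → u p p = 0) (ht : ∀ p, p ≠ t → v p p = 0) (hst : ¬ s ≤ t) :
    u * (g * v) = 0 := by
  ext p q _
  rw [IncidenceAlgebra.mul_apply, IncidenceAlgebra.zero_apply]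
  apply Finset.sum_eq_zero
  intro z _
  by_cases hz : s ≤ z
  · rw [IncidenceAlgebra.mul_apply, Finset.sum_eq_zero, mul_zero]
    intro w hw
    rw [Finset.mem_Icc] at hw
    rw [idem_left v hv t ht w (fun h => hst (hz.trans (hw.1.trans h))), mul_zero]
  · rw [idem_right u hu s hs z hz, zero_mul]

lemma refl_le [Nontrivial R] (φ : IncidenceAlgebra R P ≃ₐ[R] IncidenceAlgebra R P) (σ : P → P)
    (hσi : Function.Injective σ)
    (hσ : ∀ y a, φ a y y = a (σ y) (σ y)) (p q : P) (h : σ p ≤ σ q) : p ≤ q := by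
  by_contra hpq
  have hid : ∀ x, φ (E R x x) * φ (E R x x) = φ (E R x x) := fun x => by
    rw [← map_mul, E_idem]
  have hz : ∀ p z, z ≠ p → φ (E R (σ p) (σ p)) z z = 0 := by
    intro p z hz
    rw [hσ, E_diag, if_neg (fun h => hz (hσi h))]
  have := idem_mul _ (φ (E R (σ p) (σ q))) _ (hid (σ p)) (hid (σ q)) p q (hz p) (hz q) hpq
  rw [← map_mul, ← map_mul, E_mul_E', E_mul_E, map_eq_zero_iff φ φ.injective] at this
  have h2 := congrArg (fun f : IncidenceAlgebra R P => f (σ p) (σ q)) this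
  simp [E_apply, h] at h2

lemma E_sep [Nontrivial R] (x y : P) (h : ∀ a : IncidenceAlgebra R P, a x x = a y y) : x = y := by
  by_contra hxy
  have := h (E R x x)
  rw [E_diag, E_diag, if_pos rfl, if_neg (Ne.symm hxy)] at this
  exact one_ne_zero this

lemma aut_eq [Nontrivial R] (hR : ∀ r : R, IsIdempotentElem r → r = 0 ∨ r = 1)
    (φ : IncidenceAlgebra R P ≃ₐ[R] IncidenceAlgebra R P) :
    ∃ ρ : P ≃o P, ∀ a y, φ a y y = a (ρ y) (ρ y) := by
  have key : ∀ ψ : IncidenceAlgebra R P ≃ₐ[R] IncidenceAlgebra R P,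
      ∃ σ : P → P, ∀ y a, ψ a y y = a (σ y) (σ y) := by
    intro ψ
    have := fun y => char_eq hR ((dg y).comp ψ.toAlgHom)
    choose σ hσ using this
    exact ⟨σ, hσ⟩
  obtain ⟨σ, hσ⟩ := key φ
  obtain ⟨σ', hσ'⟩ := key φ.symm
  have h1 : ∀ y, σ' (σ y) = y := by
    intro y
    refine E_sep (R := R) _ _ fun a => ?_
    rw [← hσ', ← hσ, AlgEquiv.apply_symm_apply]
  have h2 : ∀ y, σ (σ' y) = y := by
    intro y
    refine E_sep (R := R) _ _ fun a => ?_
    rw [← hσ, ← hσ', AlgEquiv.symm_apply_apply]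
  have i1 : Function.Injective σ := Function.LeftInverse.injective h1
  have i2 : Function.Injective σ' := Function.LeftInverse.injective h2
  refine ⟨⟨⟨σ, σ', h1, h2⟩, ?_⟩, fun a y => hσ y a⟩
  intro a b
  change σ a ≤ σ b ↔ a ≤ b
  refine ⟨refl_le φ σ i1 hσ a b, fun h => refl_le φ.symm σ' i2 hσ' _ _ ?_⟩
  rwa [h1, h1]

/-- height substitute -/
noncomputable def ht (x : P) : ℕ := Nat.card (Set.Iic x)

lemma ht_lt {x y : P} (h : x < y) : ht x < ht y := by
  unfold ht
  simp only [Nat.card_coe_set_eq]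
  exact Set.ncard_lt_ncard (Set.Iic_ssubset_Iic.2 h) (Set.toFinite _)

lemma ht_iso (ρ : P ≃o P) (x : P) : ht (ρ x) = ht x := by
  unfold ht
  simp only [Nat.card_coe_set_eq]
  rw [← OrderIso.image_Iic, Set.ncard_image_of_injective _ ρ.injective]

end LocAut

/-- For a finite poset `P` and a nontrivial commutative indecomposable ring
`R`, every local automorphism `η` of the incidence algebra `I(P)` of `P` over `R` agrees
modulo the zero-diagonal ideal `Z` with `ρ̂` for some order automorphism `ρ` of `P`,
i.e. `(η a) (ρ x) (ρ x) = a x x` for all `a ∈ I(P)` and `x ∈ P`. -/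
theorem stmt19 {R : Type*} [CommRing R] [Nontrivial R]
    (hR : ∀ r : R, IsIdempotentElem r → r = 0 ∨ r = 1)
    {P : Type*} [PartialOrder P] [Fintype P] [DecidableEq P] [LocallyFiniteOrder P]
    (η : IncidenceAlgebra R P →ₗ[R] IncidenceAlgebra R P)
    (hloc : ∀ a : IncidenceAlgebra R P,
      ∃ φ : IncidenceAlgebra R P ≃ₐ[R] IncidenceAlgebra R P, η a = φ a) :
    ∃ ρ : P ≃o P, ∀ (a : IncidenceAlgebra R P) (x : P),
      η a (ρ x) (ρ x) = a x x := by
  classical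
  have hη : ∀ a, ∃ ρ : P ≃o P, ∀ y, η a y y = a (ρ y) (ρ y) := by
    intro a
    obtain ⟨φ, hφ⟩ := hloc a
    obtain ⟨ρ, hρ⟩ := LocAut.aut_eq hR φ
    exact ⟨ρ, fun y => by rw [hφ, hρ]⟩
  have hE : ∀ x, ∃ t : P, LocAut.ht t = LocAut.ht x ∧
      ∀ y, η (LocAut.E R x x) y y = if y = t then 1 else 0 := by
    intro x
    obtain ⟨ρ, hρ⟩ := hη (LocAut.E R x x)
    refine ⟨ρ.symm x, LocAut.ht_iso ρ.symm x, fun y => ?_⟩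
    rw [hρ, LocAut.E_diag]
    simp only [OrderIso.eq_symm_apply]
  choose τ hτh hτ using hE
  have hdiag : ∀ a y, η a y y = ∑ x, a x x * (if y = τ x then 1 else 0) := by
    intro a y
    have := LocAut.lin_diag ((LocAut.ev y y).comp η) (by
      intro x z hxz
      obtain ⟨ρ, hρ⟩ := hη (LocAut.E R x z)
      rw [LinearMap.comp_apply, LocAut.ev_apply, hρ, LocAut.E_off _ _ _ hxz]) a
    simp only [LinearMap.comp_apply, LocAut.ev_apply, hτ] at this
    exact this
  have hsurj : Function.Surjective τ := by
    intro y
    by_contra hne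
    push Not at hne
    have h1 := hdiag 1 y
    obtain ⟨φ, hφ⟩ := hloc 1
    rw [hφ, map_one, Finset.sum_eq_zero] at h1
    · simp at h1
    · intro x _
      rw [if_neg (hne x).symm, mul_zero]
  have hbij : Function.Bijective τ := Finite.surjective_iff_bijective.1 hsurj
  have hval : ∀ a x, η a (τ x) (τ x) = a x x := by
    intro a x
    rw [hdiag, Finset.sum_eq_single x]
    · simp
    · intro z _ hz
      rw [if_neg (fun h => hz (hbij.1 h).symm), mul_zero]
    · simp
  refine ⟨⟨Equiv.ofBijective τ hbij, ?_⟩, hval⟩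
  intro x y
  change τ x ≤ τ y ↔ x ≤ y
  by_cases hxy : x = y
  · simp [hxy]
  have hτxy : τ x ≠ τ y := fun h => hxy (hbij.1 h)
  obtain ⟨ρ, hρ⟩ := hη (LocAut.E R x x + LocAut.E R y y)
  have hmem : ∀ z, z = x ∨ z = y → ρ (τ z) = x ∨ ρ (τ z) = y := by
    intro z hz
    have h := hρ (τ z)
    rw [hval] at h
    simp only [IncidenceAlgebra.add_apply, LocAut.E_diag] at h
    by_contra hcon
    push Not at hcon
    rw [if_neg hcon.1, if_neg hcon.2] at h
    rcases hz with rfl | rfl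
    · simp [hxy] at h
    · simp [Ne.symm hxy] at h
  have hne : ρ (τ x) ≠ ρ (τ y) := fun h => hτxy (ρ.injective h)
  have hle : ∀ a b, τ a ≤ τ b ↔ ρ (τ a) ≤ ρ (τ b) := fun a b => ρ.le_iff_le.symm
  have hx := hmem x (Or.inl rfl)
  have hy := hmem y (Or.inr rfl)
  rcases hx with hx | hx <;> rcases hy with hy | hy
  · exact absurd (hx.trans hy.symm) hne
  · rw [hle, hx, hy]
  · constructor
    · intro h
      have h1 := LocAut.ht_lt (lt_of_le_of_ne h hτxy)
      rw [hle, hx, hy] at h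
      have h2 := LocAut.ht_lt (lt_of_le_of_ne h (Ne.symm hxy))
      rw [hτh, hτh] at h1
      omega
    · intro h
      have h1 := LocAut.ht_lt (lt_of_le_of_ne h hxy)
      have h3 : τ y ≤ τ x := by rw [hle, hx, hy]; exact h
      have h2 := LocAut.ht_lt (lt_of_le_of_ne h3 (Ne.symm hτxy))
      rw [hτh, hτh] at h2
      omega
  · exact absurd (hx.trans hy.symm) hne
end
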